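/- arXiv:2302.04718 — 2 statements merged into one kernel-verified Lean document; each statement's English description precedes it below -/
import Mathlib

section
/- Let q = p^h with p prime and n ≥ 2. Every nonzero codeword c of the dual code C_1(n,q)^⊥ satisfies p · wt(c) ≥ 2(θ_{n−1}(p − 1) + 1), where θ_{n−1} = (q^n − 1)/(q − 1). -/
open Submodule

/-- The points of the projective space `PG(n, K)`: the 1-dimensional
`K`-subspaces of `K^{n+1}`. -/
def PGPoint (K : Type*) [Field K] (n : ℕ) : Type _ :=
  {W : Submodule K (Fin (n + 1) → K) // Module.finrank K W = 1}

/-- The set of points of `PG(n, K)` lying in a given linear subspace. -/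
def pts {K : Type*} [Field K] {n : ℕ} (W : Submodule K (Fin (n + 1) → K)) :
    Set (PGPoint K n) :=
  {P | P.1 ≤ W}

/-- `S` is a `k`-dimensional projective subspace of `PG(n, K)`. -/
def IsKSpace {K : Type*} [Field K] {n : ℕ} (k : ℕ) (S : Set (PGPoint K n)) : Prop :=
  ∃ W : Submodule K (Fin (n + 1) → K), Module.finrank K W = k + 1 ∧ S = pts W

/-- A codeword of the dual code `C_k(n,q)^⊥`: a function from the points of
`PG(n,q)` to `𝔽_p` summing to zero on every `k`-space. -/
def InDualCode {K : Type*} [Field K] {n : ℕ} (p k : ℕ)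
    (c : PGPoint K n → ZMod p) : Prop :=
  ∀ σ : Set (PGPoint K n), IsKSpace k σ → ∑ᶠ P ∈ σ, c P = 0

/-- The weight of a codeword: the number of points with nonzero coefficient. -/
noncomputable def wt {K : Type*} [Field K] {n : ℕ} {p : ℕ} (c : PGPoint K n → ZMod p) : ℕ :=
  {P : PGPoint K n | c P ≠ 0}.ncard

open scoped Classical in
theorem aux_lines {K : Type*} [Field K] [Fintype K] {n : ℕ} [Fintype (PGPoint K n)]
    (x : PGPoint K n) (m : ℕ) (f : PGPoint K n → ℕ)
    (hf : ∀ W : Submodule K (Fin (n + 1) → K), Module.finrank K W = 2 → x.1 ≤ W →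
      m ≤ ∑ y ∈ Finset.univ.filter (fun y : PGPoint K n => y.1 ≤ W ∧ y ≠ x), f y) :
    (∑ i ∈ Finset.range n, Fintype.card K ^ i) * m
      ≤ ∑ y ∈ Finset.univ.filter (fun y : PGPoint K n => y ≠ x), f y := by
  let Q := (Fin (n + 1) → K) ⧸ x.1
  have hQ : Module.finrank K Q = n := by
    have h1 := Submodule.finrank_quotient_add_finrank x.1
    have h2 := x.2
    rw [h2, Module.finrank_fin_fun] at h1
    exact Nat.succ_injective h1
  have : Finite (Projectivization K Q) := by
    have : Finite Q := inferInstanceAs (Finite ((Fin (n + 1) → K) ⧸ x.1))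
    infer_instance
  have : Fintype (Projectivization K Q) := Fintype.ofFinite _
  have hcard := Projectivization.card_of_finrank K Q hQ
  rw [Nat.card_eq_fintype_card, Nat.card_eq_fintype_card] at hcard
  have hlift : ∀ l : Projectivization K Q, ∃ v : Fin (n + 1) → K, x.1.mkQ v = l.rep :=
    fun l => Submodule.mkQ_surjective _ _
  choose v hv using hlift
  let W : Projectivization K Q → Submodule K (Fin (n + 1) → K) := fun l => x.1 ⊔ K ∙ v l
  have hvx : ∀ l, v l ∉ x.1 := by
    intro l hl
    apply l.rep_nonzero
    rw [← hv l]
    exact (Submodule.Quotient.mk_eq_zero x.1).2 hl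
  have hW2 : ∀ l, Module.finrank K (W l) = 2 := by
    intro l
    have h1 := Submodule.finrank_sup_add_finrank_inf_eq x.1 (K ∙ v l)
    have hv0 : v l ≠ 0 := fun h => hvx l (by rw [h]; exact zero_mem _)
    have h2 : x.1 ⊓ (K ∙ v l) = ⊥ := by
      rw [← disjoint_iff]
      rw [Submodule.disjoint_span_singleton' hv0]
      exact hvx l
    rw [h2, finrank_bot, finrank_span_singleton hv0, x.2] at h1
    simpa using h1
  have hdis : ∀ l l' : Projectivization K Q, ∀ y : PGPoint K n, y ≠ x → y.1 ≤ W l →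
      y.1 ≤ W l' → l = l' := by
    intro l l' y hyx h1 h2
    obtain ⟨w, hw, hspan⟩ := finrank_eq_one_iff'.1 y.2
    have hwx : (w : Fin (n + 1) → K) ∉ x.1 := by
      intro hwx
      apply hyx
      apply Subtype.ext
      apply Submodule.eq_of_le_of_finrank_eq
      · intro z hz
        obtain ⟨k, hk⟩ := hspan ⟨z, hz⟩
        have : z = k • (w : Fin (n + 1) → K) := by
          simpa using (congrArg Subtype.val hk).symm
        rw [this]
        exact Submodule.smul_mem _ _ hwx
      · rw [x.2, y.2]
    have hw0 : x.1.mkQ (w : Fin (n + 1) → K) ≠ 0 := by simpa using hwx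
    have key : ∀ l : Projectivization K Q, y.1 ≤ W l → l = Projectivization.mk K _ hw0 := by
      intro l hl
      obtain ⟨a, ha, b, hb, hab⟩ := Submodule.mem_sup.1 (hl w.2)
      obtain ⟨k, rfl⟩ := Submodule.mem_span_singleton.1 hb
      symm
      rw [← l.mk_rep, Projectivization.mk_eq_mk_iff']
      refine ⟨k, ?_⟩
      rw [← hab, map_add, map_smul, hv l]
      have : x.1.mkQ a = 0 := by simpa using ha
      rw [this, zero_add]
    rw [key l h1, key l' h2]
  rw [← hcard]
  calc Fintype.card (Projectivization K Q) * m
      = ∑ l : Projectivization K Q, m := by simp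
    _ ≤ ∑ l : Projectivization K Q,
          ∑ y ∈ Finset.univ.filter (fun y : PGPoint K n => y.1 ≤ W l ∧ y ≠ x), f y :=
        Finset.sum_le_sum fun l _ => hf _ (hW2 l) le_sup_left
    _ = ∑ y ∈ Finset.univ.biUnion (fun l : Projectivization K Q =>
          Finset.univ.filter (fun y : PGPoint K n => y.1 ≤ W l ∧ y ≠ x)), f y := by
        rw [Finset.sum_biUnion]
        intro l _ l' _ hne
        rw [Function.onFun, Finset.disjoint_left]
        intro y hy hy'
        simp only [Finset.mem_filter, Finset.mem_univ, true_and] at hy hy'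
        exact hne (hdis l l' y hy.2 hy.1 hy'.1)
    _ ≤ _ := by
        apply Finset.sum_le_sum_of_subset
        intro y hy
        simp only [Finset.mem_biUnion, Finset.mem_filter, Finset.mem_univ, true_and] at hy ⊢
        obtain ⟨l, hl⟩ := hy
        exact hl.2

open scoped Classical in
theorem aux_split {K : Type*} [Field K] {n : ℕ} [Fintype (PGPoint K n)] {M : Type*}
    [AddCommMonoid M] (x : PGPoint K n) (f : PGPoint K n → M)
    (W : Submodule K (Fin (n + 1) → K)) (hx : x.1 ≤ W) :
    ∑ y ∈ Finset.univ.filter (fun y : PGPoint K n => y.1 ≤ W), f y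
      = f x + ∑ y ∈ Finset.univ.filter (fun y : PGPoint K n => y.1 ≤ W ∧ y ≠ x), f y := by
  rw [← Finset.add_sum_erase _ _ (show x ∈ Finset.univ.filter
    (fun y : PGPoint K n => y.1 ≤ W) by simpa using hx)]
  congr 1
  apply Finset.sum_congr _ (fun _ _ => rfl)
  ext y
  simp [and_comm]

open scoped Classical in
theorem aux_sum {K : Type*} [Field K] {n : ℕ} [Fintype (PGPoint K n)] {p : ℕ}
    (c : PGPoint K n → ZMod p) (hdual : InDualCode p 1 c)
    (W : Submodule K (Fin (n + 1) → K)) (hW : Module.finrank K W = 2) :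
    ∑ y ∈ Finset.univ.filter (fun y : PGPoint K n => y.1 ≤ W), c y = 0 := by
  rw [← hdual (pts W) ⟨W, hW, rfl⟩, finsum_mem_eq_sum_of_inter_support_eq]
  simp [pts]

open scoped Classical in
theorem aux_lift {K : Type*} [Field K] [Fintype K] {n : ℕ} [Fintype (PGPoint K n)] {p : ℕ}
    [Fact p.Prime] (c : PGPoint K n → ZMod p) (hdual : InDualCode p 1 c)
    (x : PGPoint K n) (u : ZMod p) (hu : u * c x = 1) :
    (∑ i ∈ Finset.range n, Fintype.card K ^ i) * (p - 1) + 1 ≤ ∑ y, (u * c y).val := by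
  have hp : p.Prime := Fact.out
  have : Fact (1 < p) := ⟨hp.one_lt⟩
  have hx1 : (u * c x).val = 1 := by rw [hu, ZMod.val_one]
  have h := aux_lines x (p - 1) (fun y => (u * c y).val) (by
    intro W hW hx
    have h0 := aux_sum c hdual W hW
    have h1 : ((∑ y ∈ Finset.univ.filter (fun y : PGPoint K n => y.1 ≤ W),
        (u * c y).val : ℕ) : ZMod p) = 0 := by
      push_cast
      simp only [ZMod.natCast_val, ZMod.cast_id', id]
      rw [← Finset.mul_sum, h0, mul_zero]
    rw [ZMod.natCast_eq_zero_iff, aux_split x _ W hx, hx1] at h1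
    have := Nat.le_of_dvd (by omega) h1
    omega)
  have h2 := aux_split x (fun y => (u * c y).val) ⊤ le_top
  simp only [le_top, true_and, Finset.filter_true] at h2
  rw [h2, hx1]
  omega

/-- Let `q = p ^ h` with `p` prime and `n ≥ 2`.  Every nonzero
codeword `c` of `C_1(n,q)^⊥` satisfies
`p * wt(c) ≥ 2 * (θ_{n-1} * (p - 1) + 1)`, where
`θ_{n-1} = (q^n - 1)/(q - 1) = 1 + q + ⋯ + q^{n-1}`. -/
theorem stmt1 {K : Type*} [Field K] [Fintype K] (p h n : ℕ) (hp : p.Prime)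
    (hq : Fintype.card K = p ^ h) (hn : 2 ≤ n)
    (c : PGPoint K n → ZMod p) (hc : c ≠ 0) (hdual : InDualCode p 1 c) :
    2 * ((∑ i ∈ Finset.range n, Fintype.card K ^ i) * (p - 1) + 1) ≤ p * wt c := by
  have : Fact p.Prime := ⟨hp⟩
  classical
  have : Finite (PGPoint K n) :=
    inferInstanceAs (Finite {W : Submodule K (Fin (n + 1) → K) // Module.finrank K W = 1})
  have : Fintype (PGPoint K n) := Fintype.ofFinite _
  have hwt : wt c = ∑ y, (if c y ≠ 0 then 1 else 0) := by
    rw [wt, Set.ncard_eq_toFinset_card', Finset.sum_boole]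
    simp
  obtain ⟨x, hx⟩ := Function.ne_iff.1 hc
  simp only [Pi.zero_apply] at hx
  by_cases hneg : ∃ x', c x' = - c x
  · obtain ⟨x', hx'⟩ := hneg
    have h1 := aux_lift c hdual x (c x)⁻¹ (inv_mul_cancel₀ hx)
    have h2 := aux_lift c hdual x' (-(c x)⁻¹) (by rw [hx', neg_mul_neg, inv_mul_cancel₀ hx])
    have h3 : ∑ y, ((c x)⁻¹ * c y).val + ∑ y, (-(c x)⁻¹ * c y).val = p * wt c := by
      rw [hwt, ← Finset.sum_add_distrib, Finset.mul_sum]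
      apply Finset.sum_congr rfl
      intro y _
      by_cases hy : c y = 0
      · simp [hy]
      · have hz : (c x)⁻¹ * c y ≠ 0 := mul_ne_zero (inv_ne_zero hx) hy
        have : NeZero ((c x)⁻¹ * c y) := ⟨hz⟩
        rw [neg_mul, ZMod.val_neg_of_ne_zero]
        have := ZMod.val_lt ((c x)⁻¹ * c y)
        simp only [ne_eq, hy, not_false_eq_true, if_true, mul_one]
        omega
    omega
  · push Not at hneg
    have h := aux_lines x 2 (fun y => if c y ≠ 0 then 1 else 0) (by
      intro W hW hxW
      have h0 := aux_sum c hdual W hW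
      rw [aux_split x _ W hxW, ← Finset.sum_filter_ne_zero] at h0
      rw [Finset.sum_boole, Nat.cast_id]
      by_contra hlt
      push Not at hlt
      rcases Nat.lt_succ_iff.1 hlt |>.lt_or_eq with h | h
      · rw [Nat.lt_one_iff, Finset.card_eq_zero] at h
        rw [h] at h0
        simp at h0
        exact hx h0
      · obtain ⟨y, hy⟩ := Finset.card_eq_one.1 h
        rw [hy, Finset.sum_singleton] at h0
        exact hneg y (eq_neg_of_add_eq_zero_right h0))
    have h2 := aux_split x (fun y => if c y ≠ 0 then 1 else 0) ⊤ le_top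
    simp only [le_top, true_and, Finset.filter_true] at h2
    rw [if_pos hx] at h2
    have h4 : (∑ i ∈ Finset.range n, Fintype.card K ^ i) * 2 + 1 ≤ wt c := by
      rw [hwt, h2]
      omega
    have hp2 := hp.two_le
    obtain ⟨k, rfl⟩ := Nat.exists_eq_add_of_le hp2
    have h5 := Nat.mul_le_mul_left (2 + k) h4
    refine le_trans ?_ h5
    have : 2 + k - 1 = k + 1 := by omega
    rw [this]
    generalize (∑ i ∈ Finset.range n, Fintype.card K ^ i) = r
    have e : (2 + k) * (r * 2 + 1) = 2 * (r * (k + 1) + 1) + (2 * r + k) := by ring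
    omega
end

section
/- Let q be an even prime power. Assume that every set of even type of size q(q+2) in PG(3,q) is a hypercylinder. Then for every n ≥ 3, every set of even type of size (q+2)q^{n−2} in PG(n,q) is a hypercylinder. -/
open Submodule

/-- A set of points is of even type if every line meets it in an even
number of points. -/
def IsEvenType {K : Type*} [Field K] {n : ℕ} (S : Set (PGPoint K n)) : Prop :=
  ∀ L : Set (PGPoint K n), IsKSpace 1 L → Even (S ∩ L).ncard

/-- `O` is a hyperoval in the plane `π`: a set of `q + 2` points of `π`,
no three of which are collinear. -/
def IsHyperovalIn {K : Type*} [Field K] {n : ℕ}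
    (π O : Set (PGPoint K n)) : Prop :=
  O ⊆ π ∧ O.ncard = Nat.card K + 2 ∧
    ∀ L : Set (PGPoint K n), IsKSpace 1 L → (O ∩ L).ncard ≤ 2

/-- A hypercylinder in `PG(n, K)`, `n ≥ 3`: the set
`(⋃_{P ∈ O} ⟨P, τ⟩) \ τ`, where `O` is a hyperoval in a plane `π` and the
vertex `τ` is an `(n-3)`-dimensional projective subspace (linear dimension
`n - 2`) disjoint from `π`.  (For `n = 3` the vertex is a point.) -/
def IsHypercylinder {K : Type*} [Field K] {n : ℕ}
    (S : Set (PGPoint K n)) : Prop :=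
  ∃ (Wπ T : Submodule K (Fin (n + 1) → K)) (O : Set (PGPoint K n)),
    Module.finrank K Wπ = 3 ∧ Module.finrank K T = n - 2 ∧ Wπ ⊓ T = ⊥ ∧
    IsHyperovalIn (pts Wπ) O ∧
    S = {Q : PGPoint K n | (∃ P ∈ O, Q.1 ≤ P.1 ⊔ T) ∧ ¬ Q.1 ≤ T}

set_option linter.unusedSectionVars false

theorem evx_lucas (a u u' v v' : ℕ) (hv : v < 2 ^ a) (hv' : v' < 2 ^ a) :
    Nat.choose (2 ^ a * u + v) (2 ^ a * u' + v') ≡ Nat.choose u u' * Nat.choose v v' [MOD 2] := by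
  induction a generalizing v v' with
  | zero =>
    have h1 : v = 0 := by simpa using hv
    have h2 : v' = 0 := by simpa using hv'
    subst h1 h2
    simp [Nat.ModEq.refl]
  | succ a ih =>
    have : Fact (Nat.Prime 2) := ⟨Nat.prime_two⟩
    have key : ∀ x y : ℕ, Nat.choose x y ≡ Nat.choose (x % 2) (y % 2) * Nat.choose (x / 2) (y / 2) [MOD 2] :=
      fun x y => Choose.choose_modEq_choose_mod_mul_choose_div_nat
    have e1 : (2 ^ (a + 1) * u + v) % 2 = v % 2 := by
      rw [pow_succ, mul_assoc, mul_left_comm]; omega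
    have e2 : (2 ^ (a + 1) * u' + v') % 2 = v' % 2 := by
      rw [pow_succ, mul_assoc, mul_left_comm]; omega
    have e3 : (2 ^ (a + 1) * u + v) / 2 = 2 ^ a * u + v / 2 := by
      rw [pow_succ, mul_assoc, mul_left_comm]; omega
    have e4 : (2 ^ (a + 1) * u' + v') / 2 = 2 ^ a * u' + v' / 2 := by
      rw [pow_succ, mul_assoc, mul_left_comm]; omega
    have h1 := key (2 ^ (a + 1) * u + v) (2 ^ (a + 1) * u' + v')
    rw [e1, e2, e3, e4] at h1
    have h2 := ih (v / 2) (v' / 2) (by rw [pow_succ] at hv; omega) (by rw [pow_succ] at hv'; omega)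
    refine h1.trans ((h2.mul_left _).trans ?_)
    rw [mul_left_comm]
    exact (key v v').symm.mul_left _

/-- `k` and `m` have disjoint binary expansions. -/
def EvxD (k m : ℕ) : Prop := Odd (Nat.choose (k + m) k)

theorem EvxD.comb {a x x' y y' : ℕ} (h : y + y' < 2 ^ a) (hx : EvxD x x') (hy : EvxD y y') :
    EvxD (2 ^ a * x + y) (2 ^ a * x' + y') := by
  unfold EvxD at *
  have := evx_lucas a (x + x') x (y + y') y h (by omega)
  have e : 2 ^ a * x + y + (2 ^ a * x' + y') = 2 ^ a * (x + x') + (y + y') := by ring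
  rw [e, Nat.odd_iff, this]
  exact Nat.odd_iff.1 (hx.mul hy)

theorem EvxD.zero_left (m : ℕ) : EvxD 0 m := by simp [EvxD]
theorem EvxD.zero_right (m : ℕ) : EvxD m 0 := by simp [EvxD]
theorem EvxD.one_left {m : ℕ} (h : Even m) : EvxD 1 m := by
  simp only [EvxD, Nat.choose_one_right]; exact odd_one.add_even h

theorem evx_bit (s r : ℕ) (hr : r + 1 < 2 ^ s) : ∃ j < s, EvxD r (2 ^ j) ∧ r + 2 ^ j < 2 ^ s := by
  induction s generalizing r with
  | zero => simp at hr
  | succ s ih =>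
    rcases Nat.even_or_odd r with h | h
    · refine ⟨0, by omega, ?_, by simpa using hr⟩
      simp only [EvxD, pow_zero]
      rw [Nat.choose_symm_add, Nat.choose_one_right]
      exact h.add_odd odd_one
    · obtain ⟨t, rfl⟩ := h
      obtain ⟨j, hj, hD, hlt⟩ := ih t (by rw [pow_succ] at hr; omega)
      refine ⟨j + 1, by omega, ?_, by rw [pow_succ, pow_succ] at *; omega⟩
      have := EvxD.comb (a := 1) (y := 1) (y' := 0) (by norm_num) hD (EvxD.zero_right 1)
      simpa [pow_succ, mul_comm] using this

theorem evx_exists_m (h n k : ℕ) (hh : 1 ≤ h) (hn : 2 ≤ n)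
    (hk : k + 1 < (2 ^ h + 2) * (2 ^ h) ^ (n - 2)) :
    ∃ m, 0 < m ∧ (2 ^ h - 1) ∣ m ∧ k + m < (2 ^ h) ^ n ∧ EvxD k m := by
  obtain ⟨e, rfl⟩ : ∃ e, n = e + 2 := ⟨n - 2, by omega⟩
  simp only [Nat.add_sub_cancel] at hk
  have q2 : 2 ≤ 2 ^ h := by
    calc 2 = 2 ^ 1 := by norm_num
      _ ≤ 2 ^ h := Nat.pow_le_pow_right (by norm_num) hh
  have qev : Even (2 ^ h) := (Nat.even_pow.2 ⟨even_two, by omega⟩)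
  have hQ1 : (2 ^ h) ^ e = 2 ^ (h * e) := by rw [pow_mul]
  have hQ2 : 2 ^ h * (2 ^ h) ^ e = 2 ^ (h * (e + 1)) := by rw [pow_mul, pow_succ]; ring
  have hQ3 : (2 ^ h) ^ (e + 2) = 2 ^ h * (2 ^ h * (2 ^ h) ^ e) := by ring
  have qmod : 2 ^ h ≡ 1 [MOD (2 ^ h - 1)] := by
    have : 2 ^ h = 1 + (2 ^ h - 1) := by omega
    conv_lhs => rw [this]
    simp [Nat.ModEq]
  have hexp : ∀ i, h * i = h * i := fun _ => rfl
  obtain ⟨p, hp⟩ : ∃ p, 2 ^ h = p + 2 := ⟨2 ^ h - 2, by omega⟩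
  have hp1 : 2 ^ h - 1 = p + 1 := by omega
  have pev : Even p := by
    rw [hp] at qev; simpa [Nat.even_add] using qev
  have Qpos : 0 < (2 ^ h) ^ e := by positivity
  set Q := (2 ^ h) ^ e with hQ
  have qmodp : ∀ i, (2 ^ h) ^ i ≡ 1 [MOD (2 ^ h - 1)] := fun i => by
    simpa using qmod.pow i
  have modQ : Q ≡ 1 [MOD (2 ^ h - 1)] := qmodp e
  have modqQ : 2 ^ h * Q ≡ 1 [MOD (2 ^ h - 1)] := by simpa using qmod.mul modQ
  have qQ2 : 2 * Q ≤ 2 ^ h * Q := Nat.mul_le_mul_right _ q2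
  by_cases c1 : k < 2 ^ h * Q
  · refine ⟨(p + 1) * (2 ^ h * Q), by positivity, ?_, ?_, ?_⟩
    · rw [hp1]; exact dvd_mul_right _ _
    · rw [hQ3]
      calc k + (p + 1) * (2 ^ h * Q) < (p + 2) * (2 ^ h * Q) := by nlinarith
        _ = 2 ^ h * (2 ^ h * Q) := by rw [← hp]
    · have := EvxD.comb (a := h * (e + 1)) (x := 0) (x' := p + 1) (y := k) (y' := 0)
        (by rw [← hQ2]; omega) (EvxD.zero_left _) (EvxD.zero_right _)
      rw [← hQ2] at this
      convert this using 1 <;> ring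
  · obtain ⟨r, rfl⟩ : ∃ r, k = 2 ^ h * Q + r := ⟨k - 2 ^ h * Q, by omega⟩
    have hr : r + 1 < 2 * Q := by rw [add_mul] at hk; omega
    by_cases c2 : r < Q
    · refine ⟨p * (2 ^ h * Q) + Q, by positivity, ?_, ?_, ?_⟩
      · have h1 : p * (2 ^ h * Q) + Q ≡ p * 1 + 1 [MOD (2 ^ h - 1)] := (modqQ.mul_left p).add modQ
        rw [hp1] at h1 ⊢
        have h2 : p * 1 + 1 ≡ 0 [MOD (p + 1)] := by simp [Nat.ModEq]
        exact (Nat.modEq_zero_iff_dvd).1 (h1.trans h2)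
      · rw [hQ3]
        calc 2 ^ h * Q + r + (p * (2 ^ h * Q) + Q) < (p + 2) * (2 ^ h * Q) := by nlinarith
          _ = 2 ^ h * (2 ^ h * Q) := by rw [← hp]
      · have h1 : EvxD r Q := by
          have := EvxD.comb (a := h * e) (x := 0) (x' := 1) (y := r) (y' := 0)
            (by rw [← hQ1]; omega) (EvxD.zero_left _) (EvxD.zero_right _)
          rw [← hQ1] at this
          simpa using this
        have := EvxD.comb (a := h * (e + 1)) (x := 1) (x' := p) (y := r) (y' := Q)
          (by rw [← hQ2]; omega) (EvxD.one_left pev) h1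
        rw [← hQ2] at this
        convert this using 1 <;> ring
    · obtain ⟨s, rfl⟩ : ∃ s, r = Q + s := ⟨r - Q, by omega⟩
      obtain ⟨j, hj, hjD, hjlt⟩ := evx_bit (h * e) s (by rw [← hQ1]; omega)
      rw [← hQ1] at hjlt
      have hjdecomp : 2 ^ j = (2 ^ h) ^ (j / h) * 2 ^ (j % h) := by
        rw [← pow_mul, ← pow_add, Nat.div_add_mod]
      have hc : j % h < h := Nat.mod_lt _ (by omega)
      have modj : 2 ^ j ≡ 2 ^ (j % h) [MOD (2 ^ h - 1)] := by
        rw [hjdecomp]; simpa using (qmodp (j / h)).mul_right (2 ^ (j % h))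
      obtain ⟨B, hBev, hBle, hBmod⟩ : ∃ B, Even B ∧ B + 2 ≤ 2 ^ h ∧
          (2 ^ h - 1) ∣ (p + B + 2 ^ (j % h)) := by
        rcases Nat.eq_zero_or_pos (j % h) with h0 | h0
        · exact ⟨0, by simp, by omega, by rw [h0, hp1]; simp⟩
        · have hlt : 2 ^ (j % h) < 2 ^ h := Nat.pow_lt_pow_right (by norm_num) hc
          have h2 : 2 ≤ 2 ^ (j % h) := by
            calc 2 = 2 ^ 1 := by norm_num
              _ ≤ _ := Nat.pow_le_pow_right (by norm_num) h0
          refine ⟨2 ^ h - 2 ^ (j % h), ?_, by omega, ?_⟩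
          · exact (Nat.even_sub (by omega)).2 (iff_of_true qev (Nat.even_pow.2 ⟨even_two, by omega⟩))
          · exact ⟨2, by omega⟩
      refine ⟨p * (2 ^ h * Q) + (B * Q + 2 ^ j), by positivity, ?_, ?_, ?_⟩
      · have h1 : p * (2 ^ h * Q) + (B * Q + 2 ^ j) ≡ p * 1 + (B * 1 + 2 ^ (j % h)) [MOD (2 ^ h - 1)] :=
          (modqQ.mul_left p).add ((modQ.mul_left B).add modj)
        refine (Nat.modEq_zero_iff_dvd).1 (h1.trans ?_)
        rw [Nat.modEq_zero_iff_dvd]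
        convert hBmod using 1; ring
      · rw [hQ3]
        have : (B + 2) * Q ≤ 2 ^ h * Q := Nat.mul_le_mul_right _ hBle
        calc 2 ^ h * Q + (Q + s) + (p * (2 ^ h * Q) + (B * Q + 2 ^ j)) < (p + 2) * (2 ^ h * Q) := by nlinarith
          _ = 2 ^ h * (2 ^ h * Q) := by rw [← hp]
      · have h1 : EvxD (Q + s) (B * Q + 2 ^ j) := by
          have := EvxD.comb (a := h * e) (x := 1) (x' := B) (y := s) (y' := 2 ^ j)
            (by rw [← hQ1]; omega) (EvxD.one_left hBev) hjD
          rw [← hQ1] at this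
          convert this using 1 <;> ring
        have : (B + 2) * Q ≤ 2 ^ h * Q := Nat.mul_le_mul_right _ hBle
        have := EvxD.comb (a := h * (e + 1)) (x := 1) (x' := p) (y := Q + s) (y' := B * Q + 2 ^ j)
          (by rw [← hQ2]; nlinarith) (EvxD.one_left pev) h1
        rw [← hQ2] at this
        convert this using 1 <;> ring

theorem evx_bch {K F : Type*} [Field K] [Fintype K] [Field F] [Fintype F] [Algebra K F]
    (n : ℕ) (hn : 2 ≤ n) (hcard : Fintype.card F = Fintype.card K ^ n)
    (h : ℕ) (hq : Fintype.card K = 2 ^ h) (hh : 1 ≤ h)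
    (g : F → ZMod 2) (hg : ∀ x b : F, b ≠ 0 → ∑ t : K, g (x + t • b) = 0)
    (x₀ : F) (hx₀ : g x₀ ≠ 0) :
    (Fintype.card K + 2) * Fintype.card K ^ (n - 2) ≤ {x | g x ≠ 0}.ncard := by
  classical
  have hK2 : (2 : K) = 0 := by
    have := FiniteField.cast_card_eq_zero K
    rw [hq] at this; push_cast at this
    exact pow_eq_zero_iff (by omega) |>.1 this
  have hF2 : (2 : F) = 0 := by
    have := congrArg (algebraMap K F) hK2
    rwa [map_ofNat, map_zero] at this
  have : CharP F 2 := CharTwo.of_one_ne_zero_of_two_eq_zero one_ne_zero hF2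
  let φ : ZMod 2 →+* F := ZMod.castHom (dvd_refl 2) F
  -- step 1
  have s1 : ∀ (N : ℕ) (b : F), ∑ x : F, φ (g x) * ∑ t : K, (x + t • b) ^ N = 0 := by
    intro N b
    by_cases hb : b = 0
    · subst hb
      have : (Fintype.card K : F) = 0 := by
        rw [hq]; push_cast; rw [hF2]; exact zero_pow (by omega)
      simp [this]
    · simp_rw [Finset.mul_sum]
      rw [Finset.sum_comm]
      have : ∀ t : K, ∑ x : F, φ (g x) * (x + t • b) ^ N = ∑ y : F, φ (g (y + (-t) • b)) * y ^ N := by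
        intro t
        refine Fintype.sum_equiv (Equiv.addRight (t • b)) _ _ ?_
        intro x
        simp [add_assoc]
      simp_rw [this]
      rw [Finset.sum_comm]
      refine Finset.sum_eq_zero fun y _ => ?_
      rw [← Finset.sum_mul, ← map_sum]
      have : ∑ t : K, g (y + (-t) • b) = ∑ t : K, g (y + t • b) :=
        Fintype.sum_equiv (Equiv.neg K) _ _ (fun t => by simp)
      rw [this, hg y b hb]; simp
  let P : ℕ → F := fun k => ∑ x : F, φ (g x) * x ^ k
  let σ : ℕ → F := fun m => algebraMap K F (∑ t : K, t ^ m)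
  have s2 : ∀ (N : ℕ) (b : F), ∑ x : F, φ (g x) * ∑ t : K, (x + t • b) ^ N
      = ∑ m ∈ Finset.range (N + 1), (N.choose m : F) * σ m * P (N - m) * b ^ m := by
    intro N b
    have : ∀ x : F, φ (g x) * ∑ t : K, (x + t • b) ^ N =
        ∑ m ∈ Finset.range (N + 1), (N.choose m : F) * σ m * (φ (g x) * x ^ (N - m)) * b ^ m := by
      intro x
      have : ∀ t : K, (x + t • b) ^ N = ∑ m ∈ Finset.range (N + 1),
          (algebraMap K F t) ^ m * (b ^ m * x ^ (N - m) * (N.choose m : F)) := by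
        intro t
        rw [add_comm, add_pow]
        refine Finset.sum_congr rfl fun m _ => ?_
        rw [Algebra.smul_def]; ring
      simp_rw [this]
      rw [Finset.sum_comm, Finset.mul_sum]
      refine Finset.sum_congr rfl fun m _ => ?_
      rw [← Finset.sum_mul]
      simp only [σ, map_sum, map_pow]
      ring
    simp_rw [this]
    rw [Finset.sum_comm]
    refine Finset.sum_congr rfl fun m _ => ?_
    simp only [P, Finset.mul_sum, Finset.sum_mul]
  have s3 : ∀ (N m : ℕ), N < Fintype.card F → m ≤ N → (N.choose m : F) * σ m * P (N - m) = 0 := by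
    intro N m hN hm
    let p : Polynomial F := ∑ m ∈ Finset.range (N + 1),
      Polynomial.C ((N.choose m : F) * σ m * P (N - m)) * Polynomial.X ^ m
    have hp : p = 0 := by
      refine Polynomial.eq_zero_of_natDegree_lt_card_of_eval_eq_zero p Function.injective_id ?_ ?_
      · intro b
        have := (s2 N b).symm.trans (s1 N b)
        simpa [p, Polynomial.eval_finsetSum] using this
      · refine lt_of_le_of_lt ?_ hN
        refine Polynomial.natDegree_sum_le_of_forall_le _ _ fun m hm => ?_
        refine (Polynomial.natDegree_C_mul_X_pow_le _ _).trans ?_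
        have := Finset.mem_range.1 hm; omega
    have := congrArg (fun r => Polynomial.coeff r m) hp
    simp only [p, Polynomial.finsetSum_coeff, Polynomial.coeff_C_mul, Polynomial.coeff_X_pow,
      Polynomial.coeff_zero, mul_ite, mul_one, mul_zero, Finset.sum_ite_eq, Finset.mem_range,
      Nat.lt_succ_iff, hm, if_true] at this
    exact this
  have s4 : ∀ k, k + 1 < (Fintype.card K + 2) * Fintype.card K ^ (n - 2) → P k = 0 := by
    intro k hk
    rw [hq] at hk
    obtain ⟨m, hm0, hmd, hmlt, hD⟩ := evx_exists_m h n k hh hn hk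
    have h3 := s3 (k + m) m (by rw [hcard, hq]; exact hmlt) (by omega)
    rw [Nat.add_sub_cancel] at h3
    have hc : ((k + m).choose m : F) = 1 := by
      have : Odd ((k + m).choose m) := by rw [← Nat.choose_symm_add]; exact hD
      obtain ⟨r, hr⟩ := this
      rw [hr]; push_cast; rw [hF2]; ring
    have hs : σ m = -1 := by
      have h0 : ∑ t : K, t ^ m = -1 := by
        have hu := FiniteField.sum_pow_units K m
        rw [if_pos (by rw [hq]; exact hmd)] at hu
        rw [← hu]
        rw [← Finset.sum_subset (Finset.subset_univ (Finset.univ.filter (fun t : K => t ≠ 0)))]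
        · symm
          refine Finset.sum_bij (fun (u : Kˣ) _ => (u : K)) ?_ ?_ ?_ ?_
          · intro u _; simp
          · intro a _ b _ hab; exact Units.ext hab
          · intro b hb; exact ⟨Units.mk0 b (by simpa using hb), by simp, by simp⟩
          · intro u _; simp
        · intro t _ ht
          have : t = 0 := by simpa using ht
          subst this; exact zero_pow (by omega)
      simp only [σ, h0]; simp
    rw [hc, hs] at h3
    simpa using h3
  by_contra hlt
  push Not at hlt
  let S : Finset F := Finset.univ.filter (fun x => g x ≠ 0)
  have hS : {x | g x ≠ 0}.ncard = S.card := by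
    rw [← Set.ncard_coe_finset]; congr 1; ext; simp [S]
  rw [hS] at hlt
  let r : Polynomial F := ∏ s ∈ S.erase x₀, (Polynomial.X - Polynomial.C s)
  have hx₀S : x₀ ∈ S := by simp [S, hx₀]
  have hdeg : r.natDegree = S.card - 1 := by
    rw [Polynomial.natDegree_finsetProd_X_sub_C_eq_card, Finset.card_erase_of_mem hx₀S]
  have hSpos : 0 < S.card := Finset.card_pos.2 ⟨x₀, hx₀S⟩
  have e1 : ∑ x : F, φ (g x) * r.eval x = 0 := by
    have : ∀ x, φ (g x) * r.eval x = ∑ i ∈ Finset.range (r.natDegree + 1), r.coeff i * (φ (g x) * x ^ i) := by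
      intro x
      rw [Polynomial.eval_eq_sum_range, Finset.mul_sum]
      exact Finset.sum_congr rfl fun i _ => by ring
    simp_rw [this]
    rw [Finset.sum_comm]
    refine Finset.sum_eq_zero fun i hi => ?_
    rw [← Finset.mul_sum]
    have : P i = 0 := s4 i (by have := Finset.mem_range.1 hi; omega)
    simp only [P] at this
    rw [this, mul_zero]
  rw [Finset.sum_eq_single x₀] at e1
  · have h1 : φ (g x₀) ≠ 0 := by
      intro h0; exact hx₀ (φ.injective (by rw [h0, map_zero]))
    have h2 : r.eval x₀ ≠ 0 := by
      simp only [r, Polynomial.eval_prod, Polynomial.eval_sub, Polynomial.eval_X, Polynomial.eval_C]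
      rw [Finset.prod_ne_zero_iff]
      intro s hs h0
      exact (Finset.mem_erase.1 hs).1 (sub_eq_zero.1 h0).symm
    exact (mul_ne_zero h1 h2) e1
  · intro x _ hx
    by_cases hgx : g x = 0
    · simp [hgx]
    · have : r.eval x = 0 := by
        simp only [r, Polynomial.eval_prod]
        refine Finset.prod_eq_zero (i := x) (Finset.mem_erase.2 ⟨hx, by simp [S, hgx]⟩) (by simp)
      rw [this, mul_zero]
  · intro h; exact absurd (Finset.mem_univ _) h

/-- Functions on the vectors that are indicators of sets of even type. -/
structure Evx (K : Type*) {V : Type*} [Field K] [Fintype K] [AddCommGroup V] [Module K V]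
    (f : V → ZMod 2) : Prop where
  zero : f 0 = 0
  smul : ∀ (c : K) (x : V), c ≠ 0 → f (c • x) = f x
  line : ∀ a b : V, ∑ t : K, f (a + t • b) = f b

/-- Number of vectors of the support in a subspace. -/
noncomputable def evxA {K V : Type*} [Field K] [AddCommGroup V] [Module K V]
    (f : V → ZMod 2) (W : Submodule K V) : ℕ := {x | x ∈ W ∧ f x ≠ 0}.ncard

/-- Minimal number of points, by vector space dimension. -/
def evxm (q : ℕ) : ℕ → ℕ
  | 0 => 1
  | 1 => 1
  | 2 => 2
  | (d + 3) => (q + 2) * q ^ d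

section evx
variable {K V : Type*} [Field K] [Fintype K] [AddCommGroup V] [Module K V] [Finite V]

theorem evx_ne_zero {a : ZMod 2} : a ≠ 0 ↔ a = 1 := by
  revert a; decide

theorem evx_finrank_sup {W : Submodule K V} {x : V} (hx : x ∉ W) :
    Module.finrank K ↥(W ⊔ span K {x}) = Module.finrank K W + 1 := by
  have hx0 : x ≠ 0 := fun h => hx (h ▸ W.zero_mem)
  have h1 := Submodule.finrank_sup_add_finrank_inf_eq W (span K {x})
  have h2 : W ⊓ span K {x} = ⊥ := by
    rw [eq_bot_iff]
    intro y hy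
    obtain ⟨hyW, hyx⟩ := Submodule.mem_inf.1 hy
    obtain ⟨c, rfl⟩ := mem_span_singleton.1 hyx
    by_cases hc : c = 0
    · simp [hc]
    · exact absurd ((W.smul_mem_iff hc).1 hyW) hx
  rw [h2, finrank_bot, finrank_span_singleton hx0] at h1
  omega

theorem evx_card (W : Submodule K V) :
    (W : Set V).ncard = Fintype.card K ^ Module.finrank K W := by
  rw [← Nat.card_coe_set_eq, ← Nat.card_eq_fintype_card]
  exact Module.natCard_eq_pow_finrank (K := K) (V := W)

theorem evx_exchange {W : Submodule K V} {x y : V} (hy : y ∉ W) (h : y ∈ W ⊔ span K {x}) :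
    x ∈ W ⊔ span K {y} := by
  obtain ⟨w, hw, z, hz, rfl⟩ := Submodule.mem_sup.1 h
  obtain ⟨c, rfl⟩ := mem_span_singleton.1 hz
  have hc : c ≠ 0 := by
    rintro rfl; exact hy (by simpa using hw)
  refine Submodule.mem_sup.2 ⟨-(c⁻¹ • w), W.neg_mem (W.smul_mem _ hw), c⁻¹ • (w + c • x),
    Submodule.smul_mem _ _ (mem_span_singleton_self _), ?_⟩
  rw [smul_add, smul_smul, inv_mul_cancel₀ hc]; simp

theorem evx_q_ge : 2 ≤ Fintype.card K := Fintype.one_lt_card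

/-- Double counting over the covers of `W` inside `Y`. -/
theorem evx_cover (f : V → ZMod 2) (W Y : Submodule K V) (hWY : W ≤ Y) (a c j : ℕ)
    (hj : Module.finrank K Y = Module.finrank K W + j)
    (hc : evxA f Y = evxA f W + c)
    (h : ∀ x ∈ Y, x ∉ W → evxA f W + a ≤ evxA f (W ⊔ span K {x})) :
    (Fintype.card K ^ j - 1) * a ≤ (Fintype.card K - 1) * c ∧
    ((Fintype.card K - 1) * c ≤ (Fintype.card K ^ j - 1) * a →
      ∀ x ∈ Y, x ∉ W → evxA f (W ⊔ span K {x}) = evxA f W + a) := by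
  classical
  have := Fintype.ofFinite V
  set q := Fintype.card K with hq
  have hq2 : 2 ≤ q := evx_q_ge
  set w := Module.finrank K W with hw
  have qpos : 0 < q ^ w := by positivity
  let X : Finset V := Finset.univ.filter (fun x => x ∈ Y ∧ x ∉ W)
  let Z : Finset V := Finset.univ.filter (fun x => x ∈ Y ∧ x ∉ W ∧ f x ≠ 0)
  let B : V → Finset V := fun x => Z.filter (fun y => y ∈ W ⊔ span K {x})
  have cardset : ∀ U : Submodule K V, (Finset.univ.filter (fun x => x ∈ U)).card = q ^ Module.finrank K U := by
    intro U
    rw [hq, ← evx_card, ← Set.ncard_coe_finset]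
    congr 1; ext; simp
  have cardA : ∀ U : Submodule K V, evxA f U = (Finset.univ.filter (fun x => x ∈ U ∧ f x ≠ 0)).card := by
    intro U
    rw [evxA, ← Set.ncard_coe_finset]
    congr 1; ext; simp
  have carddiff : ∀ U : Submodule K V, W ≤ U →
      (Finset.univ.filter (fun x => x ∈ U ∧ x ∉ W)).card + q ^ w = q ^ Module.finrank K U := by
    intro U hU
    rw [← cardset U, ← cardset W, ← Finset.card_union_of_disjoint]
    · congr 1; ext x; simp
      constructor
      · rintro (h | h); exact h.1; exact hU h
      · intro h; by_cases hx : x ∈ W <;> simp [h, hx]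
    · rw [Finset.disjoint_filter]; rintro x _ h; exact h.2
  have cardAdiff : ∀ U : Submodule K V, W ≤ U →
      evxA f U = evxA f W + (Finset.univ.filter (fun x => x ∈ U ∧ x ∉ W ∧ f x ≠ 0)).card := by
    intro U hU
    rw [cardA, cardA, ← Finset.card_union_of_disjoint]
    · congr 1; ext x; simp
      constructor
      · rintro ⟨h, h'⟩; by_cases hx : x ∈ W <;> simp [h, h', hx]
      · rintro (h | h); exact ⟨hU h.1, h.2⟩; exact ⟨h.1, h.2.2⟩
    · rw [Finset.disjoint_filter]; rintro x _ h h'; exact h'.2.1 h.1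
  have hZ : Z.card = c := by
    have := cardAdiff Y hWY
    rw [hc] at this
    simp only [Z]; omega
  have hX : X.card = q ^ w * (q ^ j - 1) := by
    have := carddiff Y hWY
    rw [hj, pow_add] at this
    simp only [X]
    rw [Nat.mul_sub, mul_one]; omega
  have hB : ∀ x ∈ Y, x ∉ W → evxA f (W ⊔ span K {x}) = evxA f W + (B x).card := by
    intro x hxY hxW
    rw [cardAdiff _ le_sup_left]
    congr 2
    ext y
    simp only [B, Z, Finset.mem_filter, Finset.mem_univ, true_and]
    have hle : W ⊔ span K {x} ≤ Y := sup_le hWY (by rwa [span_singleton_le_iff_mem])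
    constructor
    · rintro ⟨h1, h2, h3⟩; exact ⟨⟨hle h1, h2, h3⟩, h1⟩
    · rintro ⟨⟨h1, h2, h3⟩, h4⟩; exact ⟨h4, h2, h3⟩
  have hsum : ∑ x ∈ X, (B x).card = q ^ w * ((q - 1) * c) := by
    have := Finset.sum_card_bipartiteAbove_eq_sum_card_bipartiteBelow
      (s := X) (t := Z) (fun x y => y ∈ W ⊔ span K {x})
    have e : ∀ y ∈ Z, (X.bipartiteBelow (fun x y => y ∈ W ⊔ span K {x}) y).card = q ^ w * (q - 1) := by
      intro y hy
      simp only [Z, Finset.mem_filter, Finset.mem_univ, true_and] at hy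
      have h1 := carddiff (W ⊔ span K {y}) le_sup_left
      rw [evx_finrank_sup hy.2.1, ← hw, pow_succ] at h1
      have : X.bipartiteBelow (fun x y => y ∈ W ⊔ span K {x}) y =
          Finset.univ.filter (fun x => x ∈ W ⊔ span K {y} ∧ x ∉ W) := by
        ext x
        simp only [Finset.mem_bipartiteBelow, X, Finset.mem_filter, Finset.mem_univ, true_and]
        constructor
        · rintro ⟨⟨h1, h2⟩, h3⟩; exact ⟨evx_exchange hy.2.1 h3, h2⟩
        · rintro ⟨h1, h2⟩
          exact ⟨⟨(sup_le hWY (by rw [span_singleton_le_iff_mem]; exact hy.1)) h1, h2⟩, evx_exchange h2 h1⟩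
      rw [this, Nat.mul_sub, mul_one]; omega
    rw [Finset.sum_congr rfl e, Finset.sum_const, hZ, smul_eq_mul] at this
    simp only [Finset.bipartiteAbove] at this
    rw [this]; ring
  have hge : ∀ x ∈ X, a ≤ (B x).card := by
    intro x hx
    simp only [X, Finset.mem_filter, Finset.mem_univ, true_and] at hx
    have h1 := h x hx.1 hx.2
    rw [hB x hx.1 hx.2] at h1; omega
  have h1 : X.card * a ≤ ∑ x ∈ X, (B x).card := by
    simpa using Finset.card_nsmul_le_sum X _ a hge
  refine ⟨?_, ?_⟩
  · rw [hsum, hX, mul_assoc] at h1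
    exact Nat.le_of_mul_le_mul_left h1 qpos
  · intro hle x hxY hxW
    have h2 : ∑ x ∈ X, a = ∑ x ∈ X, (B x).card := by
      refine le_antisymm (by simpa using h1) ?_
      rw [hsum, Finset.sum_const, hX, smul_eq_mul, mul_assoc]
      exact Nat.mul_le_mul_left _ hle
    have h3 := (Finset.sum_eq_sum_iff_of_le hge).1 h2 x (by simp [X, hxY, hxW])
    rw [hB x hxY hxW, ← h3]


theorem evx_mono (f : V → ZMod 2) {W Y : Submodule K V} (h : W ≤ Y) : evxA f W ≤ evxA f Y :=
  Set.ncard_le_ncard (fun _ hx => ⟨h hx.1, hx.2⟩) (Set.toFinite _)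

/-- Counting points through vectors. -/
theorem evx_points (A : Set V) (h0 : (0 : V) ∉ A) (hs : ∀ (c : K) (x : V), c ≠ 0 → x ∈ A → c • x ∈ A) :
    A.ncard = (Fintype.card K - 1) * ((fun x => span K {x}) '' A).ncard := by
  classical
  have := Fintype.ofFinite V
  let A' : Finset V := A.toFinset
  have e1 : A.ncard = A'.card := by rw [← Set.ncard_coe_finset]; simp [A']
  have e2 : ((fun x => span K {x}) '' A).ncard = (A'.image (fun x => span K {x})).card := by
    rw [← Set.ncard_coe_finset]; simp [A']
  rw [e1, e2, mul_comm]
  rw [Finset.card_eq_sum_card_image (fun x => span K {x}) A']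
  rw [Finset.sum_const_nat (m := Fintype.card K - 1)]
  intro P hP
  obtain ⟨x, hx, rfl⟩ := Finset.mem_image.1 hP
  have hxA : x ∈ A := by simpa [A'] using hx
  have hx0 : x ≠ 0 := fun h => h0 (h ▸ hxA)
  have : A'.filter (fun y => span K {y} = span K {x}) =
      (Finset.univ.filter (fun c : K => c ≠ 0)).image (fun c => c • x) := by
    ext y
    simp only [Finset.mem_filter, Finset.mem_image, Finset.mem_univ, true_and]
    constructor
    · rintro ⟨hy, hspan⟩
      have hy0 : y ≠ 0 := by rintro rfl; exact h0 (by simpa [A'] using hy)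
      have : y ∈ span K {x} := hspan ▸ mem_span_singleton_self y
      obtain ⟨c, rfl⟩ := mem_span_singleton.1 this
      exact ⟨c, fun hc => hy0 (by simp [hc]), rfl⟩
    · rintro ⟨c, hc, rfl⟩
      refine ⟨by simpa [A'] using hs c x hc hxA, ?_⟩
      exact span_singleton_smul_eq (IsUnit.mk0 c hc) x
  rw [this, Finset.card_image_of_injective _ (smul_left_injective K hx0), Finset.filter_ne',
    Finset.card_erase_of_mem (Finset.mem_univ _), Finset.card_univ]

theorem Evx.dvd {f : V → ZMod 2} (hf : Evx K f) (W : Submodule K V) :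
    (Fintype.card K - 1) ∣ evxA f W := by
  refine ⟨_, evx_points (K := K) {x | x ∈ W ∧ f x ≠ 0} ?_ ?_⟩
  · simp [hf.zero]
  · rintro c x hc ⟨h1, h2⟩
    exact ⟨W.smul_mem _ h1, by rwa [hf.smul c x hc]⟩

theorem Evx.span {f : V → ZMod 2} (hf : Evx K f) {p : V} (hp : f p ≠ 0) :
    evxA f (span K {p}) = Fintype.card K - 1 := by
  classical
  have hp0 : p ≠ 0 := by rintro rfl; exact hp hf.zero
  have : {x | x ∈ Submodule.span K {p} ∧ f x ≠ 0} =
      ((Finset.univ.filter (fun c : K => c ≠ 0)).image (fun c => c • p) : Finset V) := by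
    ext y
    simp only [Set.mem_ofPred_eq, Finset.coe_image, Set.mem_image, Finset.coe_filter, Finset.mem_univ, true_and]
    constructor
    · rintro ⟨h1, h2⟩
      obtain ⟨c, rfl⟩ := mem_span_singleton.1 h1
      exact ⟨c, fun hc => h2 (by simp [hc, hf.zero]), rfl⟩
    · rintro ⟨c, hc, rfl⟩
      exact ⟨Submodule.smul_mem _ _ (mem_span_singleton_self _), by rwa [hf.smul c p hc]⟩
  rw [evxA, this, Set.ncard_coe_finset,
    Finset.card_image_of_injective _ (smul_left_injective K hp0), Finset.filter_ne',
    Finset.card_erase_of_mem (Finset.mem_univ _), Finset.card_univ]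

theorem Evx.line_ge {f : V → ZMod 2} (hf : Evx K f) {p x : V} (hp : f p ≠ 0)
    (hx : x ∉ Submodule.span K {p}) :
    2 * (Fintype.card K - 1) ≤ evxA f (Submodule.span K {p} ⊔ Submodule.span K {x}) := by
  classical
  obtain ⟨y, hy, hyp, hfy⟩ : ∃ y ∈ Submodule.span K {p} ⊔ Submodule.span K {x},
      y ∉ Submodule.span K {p} ∧ f y ≠ 0 := by
    by_cases hfx : f x = 0
    · have h1 := hf.line p x
      rw [hfx] at h1
      by_contra hno
      push Not at hno
      rw [Finset.sum_eq_single 0] at h1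
      · simp at h1; exact hp h1
      · intro t _ ht
        apply hno
        · exact Submodule.add_mem _ (Submodule.mem_sup_left (mem_span_singleton_self _))
            (Submodule.mem_sup_right (Submodule.smul_mem _ _ (mem_span_singleton_self _)))
        · intro hmem
          have := (Submodule.add_mem_iff_right _ (mem_span_singleton_self p)).1 hmem
          exact hx ((Submodule.smul_mem_iff _ ht).1 this)
      · intro h; exact absurd (Finset.mem_univ _) h
    · exact ⟨x, Submodule.mem_sup_right (mem_span_singleton_self _), hx, hfx⟩
  have h1 := hf.span hp
  have h2 := hf.span hfy
  have hd : Disjoint {z | z ∈ Submodule.span K {p} ∧ f z ≠ 0} {z | z ∈ Submodule.span K {y} ∧ f z ≠ 0} := by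
    rw [Set.disjoint_left]
    rintro z ⟨hz1, hz2⟩ ⟨hz3, -⟩
    obtain ⟨c, rfl⟩ := mem_span_singleton.1 hz3
    have hc : c ≠ 0 := by rintro rfl; exact hz2 (by simp [hf.zero])
    exact hyp ((Submodule.smul_mem_iff _ hc).1 hz1)
  unfold evxA at h1 h2 ⊢
  rw [two_mul]
  conv_lhs => rw [← h1]
  have e : Fintype.card K - 1 = {z | z ∈ Submodule.span K {y} ∧ f z ≠ 0}.ncard := h2.symm
  calc _ = {z | z ∈ Submodule.span K {p} ∧ f z ≠ 0}.ncard + {z | z ∈ Submodule.span K {y} ∧ f z ≠ 0}.ncard := by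
        rw [h1, h2]
    _ = ({z | z ∈ Submodule.span K {p} ∧ f z ≠ 0} ∪ {z | z ∈ Submodule.span K {y} ∧ f z ≠ 0}).ncard :=
        (Set.ncard_union_eq hd (Set.toFinite _) (Set.toFinite _)).symm
    _ ≤ _ := by
        refine Set.ncard_le_ncard ?_ (Set.toFinite _)
        rintro z (⟨h, h'⟩ | ⟨h, h'⟩)
        · exact ⟨Submodule.mem_sup_left h, h'⟩
        · refine ⟨?_, h'⟩
          have : Submodule.span K {y} ≤ Submodule.span K {p} ⊔ Submodule.span K {x} := by
            rwa [span_singleton_le_iff_mem]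
          exact this h

/-- Counting with periods. -/
theorem evx_periods {f : V → ZMod 2} (C T : Submodule K V) (hCT : C ⊓ T = ⊥)
    (hT : ∀ v ∈ T, ∀ x ∈ C, f (x + v) = f x) :
    evxA f (C ⊔ T) = Fintype.card K ^ Module.finrank K T * evxA f C := by
  rw [← evx_card, mul_comm]
  unfold evxA
  rw [← Set.ncard_prod]
  have : {x | x ∈ C ⊔ T ∧ f x ≠ 0} = (fun z : V × V => z.1 + z.2) '' ({x | x ∈ C ∧ f x ≠ 0} ×ˢ (T : Set V)) := by
    ext y
    simp only [Set.mem_ofPred_eq, Set.mem_image, Set.mem_prod, SetLike.mem_coe, Prod.exists]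
    constructor
    · rintro ⟨h1, h2⟩
      obtain ⟨c, hc, t, ht, rfl⟩ := Submodule.mem_sup.1 h1
      exact ⟨c, t, ⟨⟨hc, by rwa [hT t ht c hc] at h2⟩, ht⟩, rfl⟩
    · rintro ⟨c, t, ⟨⟨hc, h⟩, ht⟩, rfl⟩
      exact ⟨Submodule.add_mem_sup hc ht, by rwa [hT t ht c hc]⟩
  rw [this, Set.InjOn.ncard_image]
  rintro ⟨c, t⟩ ⟨⟨hc, -⟩, ht⟩ ⟨c', t'⟩ ⟨⟨hc', -⟩, ht'⟩ heq
  simp only [SetLike.mem_coe] at hc hc' ht ht' heq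
  have h1 : c - c' = t' - t := by rw [sub_eq_sub_iff_add_eq_add, heq, add_comm]
  have h2 : c - c' ∈ C ⊓ T := ⟨C.sub_mem hc hc', h1 ▸ T.sub_mem ht' ht⟩
  rw [hCT, Submodule.mem_bot] at h2
  have h3 : t' - t = 0 := h1 ▸ h2
  rw [sub_eq_zero] at h2 h3
  rw [h2, h3]

theorem Evx.hyperoval {f : V → ZMod 2} (hf : Evx K f) (C L : Submodule K V) (hLC : L ≤ C)
    (hC : Module.finrank K C = 3) (hL : Module.finrank K L = 2)
    (hA : evxA f C = (Fintype.card K - 1) * (Fintype.card K + 2)) :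
    evxA f L ≤ 2 * (Fintype.card K - 1) := by
  by_cases hex : ∃ p ∈ L, f p ≠ 0
  · obtain ⟨p, hpL, hp⟩ := hex
    have hp0 : p ≠ 0 := by rintro rfl; exact hp hf.zero
    have hpC : Submodule.span K {p} ≤ C := by rw [span_singleton_le_iff_mem]; exact hLC hpL
    have hpL' : Submodule.span K {p} ≤ L := by rwa [span_singleton_le_iff_mem]
    have hr : Module.finrank K (Submodule.span K {p}) = 1 := finrank_span_singleton hp0
    have hlt : Submodule.span K {p} < L := lt_of_le_of_ne hpL' (by
      intro h; rw [h] at hr; omega)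
    obtain ⟨x, hxL, hxp⟩ := SetLike.exists_of_lt hlt
    have hq2 : 2 ≤ Fintype.card K := evx_q_ge
    obtain ⟨r, hr'⟩ : ∃ r, Fintype.card K = r + 2 := ⟨Fintype.card K - 2, by omega⟩
    have hcov := (evx_cover f (Submodule.span K {p}) C hpC (Fintype.card K - 1)
      ((Fintype.card K - 1) * (Fintype.card K + 1)) 2 (by rw [hC, hr])
      (by rw [hA, hf.span hp]; ring) (by
        intro x _ hx
        rw [hf.span hp]; have := hf.line_ge hp hx; omega)).2 (by
        rw [hr']; simp only [Nat.add_sub_cancel, show r + 2 - 1 = r + 1 by omega]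
        have : (r + 2) ^ 2 - 1 = (r + 1) * (r + 3) := by
          have : (r + 2) ^ 2 = (r + 1) * (r + 3) + 1 := by ring
          omega
        rw [this]; apply le_of_eq; ring) x (hLC hxL) hxp
    have hLeq : Submodule.span K {p} ⊔ Submodule.span K {x} = L := by
      apply Submodule.eq_of_le_of_finrank_eq
      · exact sup_le hpL' (by rwa [span_singleton_le_iff_mem])
      · rw [evx_finrank_sup hxp, hr, hL]
    rw [hLeq, hf.span hp] at hcov
    omega
  · push Not at hex
    have : evxA f L = 0 := by
      unfold evxA
      rw [Set.ncard_eq_zero (Set.toFinite _)]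
      ext x; simp; exact hex x
    omega
end evx

section evx
variable {K V : Type*} [Field K] [Fintype K] [AddCommGroup V] [Module K V] [Finite V]

theorem evx_card_two_pow (hq : Even (Fintype.card K)) : ∃ h, 1 ≤ h ∧ Fintype.card K = 2 ^ h := by
  obtain ⟨p, hchar, n, hp, h⟩ := FiniteField.card' K
  have h2 : 2 ∣ p ^ (n : ℕ) := by rw [← h]; exact hq.two_dvd
  have h3 := (Nat.prime_dvd_prime_iff_eq Nat.prime_two hp).1 (Nat.prime_two.dvd_of_dvd_pow h2)
  exact ⟨n, n.pos, by rw [h, h3]⟩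

/-- The affine bound. -/
theorem evx_affine (hq : Even (Fintype.card K)) (E : Submodule K V) (hE : 2 ≤ Module.finrank K E)
    (g : V → ZMod 2) (hg : ∀ x ∈ E, ∀ b ∈ E, b ≠ 0 → ∑ t : K, g (x + t • b) = 0)
    (x₀ : V) (hx₀E : x₀ ∈ E) (hx₀ : g x₀ ≠ 0) :
    (Fintype.card K + 2) * Fintype.card K ^ (Module.finrank K E - 2) ≤
      {x | x ∈ E ∧ g x ≠ 0}.ncard := by
  classical
  obtain ⟨h, hh, hcard⟩ := evx_card_two_pow hq
  have hK2 : (2 : K) = 0 := by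
    have := FiniteField.cast_card_eq_zero K
    rw [hcard] at this; push_cast at this
    exact pow_eq_zero_iff (by omega) |>.1 this
  have : Fact (Nat.Prime 2) := ⟨Nat.prime_two⟩
  have : CharP K 2 := CharTwo.of_one_ne_zero_of_two_eq_zero one_ne_zero hK2
  set n := Module.finrank K E with hn
  have : NeZero n := ⟨by omega⟩
  let F := FiniteField.Extension K 2 n
  have hF : Module.finrank K F = n := FiniteField.finrank_extension K 2 n
  have : Finite F := Module.finite_of_finite K
  have : Fintype F := Fintype.ofFinite F
  have hcF : Fintype.card F = Fintype.card K ^ n := by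
    rw [Module.card_eq_pow_finrank (K := K), hF]
  let e : F ≃ₗ[K] E := LinearEquiv.ofFinrankEq F E hF
  have key := evx_bch (K := K) (F := F) n hE hcF h hcard hh (fun z => g (e z)) (by
    intro x b hb
    have := hg (e x) (e x).2 (e b) (e b).2 (by
      intro h0; apply hb; apply e.injective; rw [map_zero]; exact Subtype.ext h0)
    simpa using this) (e.symm ⟨x₀, hx₀E⟩) (by simpa using hx₀)
  refine key.trans (le_of_eq ?_)
  have : {x | x ∈ E ∧ g x ≠ 0} = (fun z : F => (e z : V)) '' {z | g (e z) ≠ 0} := by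
    ext y
    constructor
    · rintro ⟨h1, h2⟩
      exact ⟨e.symm ⟨y, h1⟩, by simpa using h2, by simp⟩
    · rintro ⟨z, hz, rfl⟩
      exact ⟨(e z).2, hz⟩
  rw [this, Set.InjOn.ncard_image]
  intro a _ b _ hab
  exact e.injective (Subtype.ext hab)

theorem evx_arith (q w j : ℕ) (hq : 2 ≤ q) (hj : 2 ≤ j) (hwj : 3 ≤ w + j) :
    (q - 1) * evxm q (w + j) < (q ^ j - 1) * evxm q (w + 1) := by
  obtain ⟨p, rfl⟩ : ∃ p, q = p + 1 := ⟨q - 1, by omega⟩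
  simp only [Nat.add_sub_cancel]
  have hp : 1 ≤ p := by omega
  match w with
  | 0 =>
    obtain ⟨i, rfl⟩ : ∃ i, j = i + 3 := ⟨j - 3, by omega⟩
    rw [show 0 + (i + 3) = i + 3 by ring]
    simp only [evxm]
    have : 1 ≤ (p + 1) ^ i := Nat.one_le_pow _ _ (by omega)
    have e : (p + 1) ^ (i + 3) = (p + 1) ^ 3 * (p + 1) ^ i := by ring
    rw [mul_one]
    apply Nat.lt_sub_of_add_lt
    rw [e]
    generalize (p + 1) ^ i = Q at *
    have : p * (p + 3) + 1 < (p + 1) ^ 3 := by nlinarith [Nat.mul_le_mul hp hp]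
    nlinarith
  | 1 =>
    obtain ⟨i, rfl⟩ : ∃ i, j = i + 2 := ⟨j - 2, by omega⟩
    rw [show 1 + (i + 2) = i + 3 by ring]
    simp only [evxm]
    have : 1 ≤ (p + 1) ^ i := Nat.one_le_pow _ _ (by omega)
    have e : (p + 1) ^ (i + 2) = (p + 1) ^ 2 * (p + 1) ^ i := by ring
    rw [Nat.sub_mul]
    apply Nat.lt_sub_of_add_lt
    rw [e]
    generalize (p + 1) ^ i = Q at *
    have : p * (p + 3) + 2 < 2 * (p + 1) ^ 2 := by nlinarith
    nlinarith
  | (v + 2) =>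
    obtain ⟨i, rfl⟩ : ∃ i, j = i + 2 := ⟨j - 2, by omega⟩
    rw [show v + 2 + (i + 2) = (v + i + 1) + 3 by ring, show v + 2 + 1 = v + 3 by ring]
    simp only [evxm]
    have h1 : 1 ≤ (p + 1) ^ i := Nat.one_le_pow _ _ (by omega)
    have h2 : 1 ≤ (p + 1) ^ v := Nat.one_le_pow _ _ (by omega)
    have e1 : (p + 1) ^ (v + i + 1) = (p + 1) ^ v * (p + 1) ^ i * (p + 1) := by ring
    have e2 : (p + 1) ^ (i + 2) = (p + 1) ^ 2 * (p + 1) ^ i := by ring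
    rw [e1, e2]
    have key : p * ((p + 1) ^ i * (p + 1)) < (p + 1) ^ 2 * (p + 1) ^ i - 1 := by
      apply Nat.lt_sub_of_add_lt
      generalize (p + 1) ^ i = Q at *
      nlinarith
    calc p * ((p + 1 + 2) * ((p + 1) ^ v * (p + 1) ^ i * (p + 1)))
        = (p * ((p + 1) ^ i * (p + 1))) * ((p + 1 + 2) * (p + 1) ^ v) := by ring
      _ < _ := Nat.mul_lt_mul_of_pos_right key (by positivity)

theorem evxA_eq_zero {f : V → ZMod 2} {W : Submodule K V} : evxA f W = 0 ↔ ∀ x ∈ W, f x = 0 := by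
  unfold evxA
  rw [Set.ncard_eq_zero (Set.toFinite _)]
  constructor
  · intro h x hx
    by_contra h0
    have : x ∈ ({x | x ∈ W ∧ f x ≠ 0} : Set V) := ⟨hx, h0⟩
    rw [h] at this; exact this
  · intro h
    ext x; simp; exact h x

/-- Either there is an empty hyperplane or the set is large. -/
theorem evx_empty_hyperplane {f : V → ZMod 2} (hf : Evx K f) (Y : Submodule K V)
    (hY : 3 ≤ Module.finrank K Y)
    (ih : ∀ W : Submodule K V, Module.finrank K W < Module.finrank K Y → (∃ x ∈ W, f x ≠ 0) →
      (Fintype.card K - 1) * evxm (Fintype.card K) (Module.finrank K W) ≤ evxA f W) :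
    (∃ E ≤ Y, Module.finrank K E + 1 = Module.finrank K Y ∧ ∀ x ∈ E, f x = 0) ∨
    (∃ x ∈ Y, f x ≠ 0) ∧ (Fintype.card K - 1) * evxm (Fintype.card K) (Module.finrank K Y) < evxA f Y ∨
    ∀ x ∈ Y, f x = 0 := by
  classical
  by_cases hall : ∀ x ∈ Y, f x = 0
  · exact Or.inr (Or.inr hall)
  have hq2 : 2 ≤ Fintype.card K := evx_q_ge
  obtain ⟨W, ⟨hWY, hW0⟩, hmax⟩ := (Set.toFinite {W : Submodule K V | W ≤ Y ∧ ∀ x ∈ W, f x = 0}).exists_maximalFor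
    (fun W : Submodule K V => Module.finrank K W) _ ⟨⊥, bot_le, by simpa using hf.zero⟩
  have hcov : ∀ x ∈ Y, x ∉ W → ∃ y ∈ W ⊔ span K {x}, f y ≠ 0 := by
    intro x hxY hxW
    by_contra hno
    push Not at hno
    have := hmax (j := W ⊔ span K {x}) ⟨sup_le hWY (by rwa [span_singleton_le_iff_mem]), hno⟩
      (by simp only; rw [evx_finrank_sup hxW]; omega)
    simp only at this
    rw [evx_finrank_sup hxW] at this
    omega
  have hle : Module.finrank K W ≤ Module.finrank K Y := Submodule.finrank_mono hWY
  obtain ⟨j, hj⟩ : ∃ j, Module.finrank K Y = Module.finrank K W + j := ⟨_, (Nat.add_sub_cancel' hle).symm⟩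
  have hj0 : j ≠ 0 := by
    rintro rfl
    have := Submodule.eq_of_le_of_finrank_eq hWY (by omega)
    exact hall (this ▸ hW0)
  by_cases hj1 : j = 1
  · exact Or.inl ⟨W, hWY, by omega, hW0⟩
  refine Or.inr (Or.inl ⟨by push Not at hall; exact hall, ?_⟩)
  have hAW : evxA f W = 0 := evxA_eq_zero.2 hW0
  have h1 := (evx_cover f W Y hWY ((Fintype.card K - 1) * evxm (Fintype.card K) (Module.finrank K W + 1))
    (evxA f Y) j hj (by rw [hAW, zero_add]) (by
      intro x hxY hxW
      rw [hAW, zero_add, ← evx_finrank_sup hxW]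
      apply ih _ _ (hcov x hxY hxW)
      rw [evx_finrank_sup hxW]; omega)).1
  have h2 := evx_arith (Fintype.card K) (Module.finrank K W) j hq2 (by omega) (by omega)
  rw [← hj] at h2
  have hpos : 0 < Fintype.card K - 1 := by omega
  have h3 : (Fintype.card K - 1) * ((Fintype.card K - 1) * evxm (Fintype.card K) (Module.finrank K Y)) <
      (Fintype.card K - 1) * evxA f Y := by
    refine lt_of_lt_of_le (Nat.mul_lt_mul_of_pos_left h2 hpos) (le_trans (le_of_eq ?_) h1)
    ring
  exact Nat.lt_of_mul_lt_mul_left h3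

theorem Evx.lower {f : V → ZMod 2} (hf : Evx K f) (hq : Even (Fintype.card K)) (Y : Submodule K V)
    (hY : ∃ x ∈ Y, f x ≠ 0) :
    (Fintype.card K - 1) * evxm (Fintype.card K) (Module.finrank K Y) ≤ evxA f Y := by
  classical
  induction hd : Module.finrank K Y using Nat.strong_induction_on generalizing Y with
  | _ d ih =>
  obtain ⟨p, hpY, hp⟩ := hY
  have hp0 : p ≠ 0 := by rintro rfl; exact hp hf.zero
  have hpY' : Submodule.span K {p} ≤ Y := by rwa [span_singleton_le_iff_mem]
  have hr : Module.finrank K (Submodule.span K {p}) = 1 := finrank_span_singleton hp0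
  have hd1 : 1 ≤ d := by rw [← hr, ← hd]; exact Submodule.finrank_mono hpY'
  match d, hd1 with
  | 1, _ =>
    simp only [evxm, mul_one]
    rw [← hf.span hp]
    exact evx_mono f hpY'
  | 2, _ =>
    have hlt : Submodule.span K {p} < Y := lt_of_le_of_ne hpY' (by
      intro h; rw [h] at hr; omega)
    obtain ⟨x, hxY, hxp⟩ := SetLike.exists_of_lt hlt
    simp only [evxm]
    rw [mul_comm]
    exact (hf.line_ge hp hxp).trans (evx_mono f (sup_le hpY' (by rwa [span_singleton_le_iff_mem])))
  | (e + 3), _ =>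
    rcases evx_empty_hyperplane hf Y (by omega) (by
      intro W hW hex
      exact ih _ (by omega) W hex rfl) with ⟨E, hEY, hE, hE0⟩ | ⟨-, h⟩ | h
    · have hpE : p ∉ E := fun h => hp (hE0 p h)
      have hfin : Module.finrank K E = e + 2 := by omega
      have h1 := evx_affine hq E (by omega) (fun x => f (p + x)) (by
        intro x hx b hb _
        have := hf.line (p + x) b
        rw [hE0 b hb] at this
        simpa [add_assoc] using this) 0 E.zero_mem (by simpa using hp)
      rw [hfin, Nat.add_sub_cancel] at h1
      simp only [evxm]
      refine (Nat.mul_le_mul_left _ h1).trans ?_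
      have hcK : {c : K | c ≠ 0}.ncard = Fintype.card K - 1 := by
        have : {c : K | c ≠ 0} = ((Finset.univ.erase (0 : K) : Finset K) : Set K) := by ext; simp
        rw [this, Set.ncard_coe_finset, Finset.card_erase_of_mem (Finset.mem_univ _), Finset.card_univ]
      rw [← hcK, ← Set.ncard_prod]
      refine Set.ncard_le_ncard_of_injOn (fun z : K × V => z.1 • (p + z.2)) ?_ ?_ (Set.toFinite _)
      · rintro ⟨c, x⟩ ⟨hc, hx, hfx⟩
        refine ⟨Y.smul_mem _ (Y.add_mem hpY (hEY hx)), ?_⟩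
        simp only
        rw [hf.smul c _ hc]; exact hfx
      · rintro ⟨c, x⟩ ⟨hc, hx, hfx⟩ ⟨c', x'⟩ ⟨hc', hx', hfx'⟩ heq
        simp only at hc hc' hx hx' heq
        have hmem : (c - c') • p ∈ E := by
          have : (c - c') • p = c' • x' - c • x := by
            rw [smul_add, smul_add] at heq
            rw [sub_smul, sub_eq_sub_iff_add_eq_add, heq, add_comm]
          rw [this]; exact E.sub_mem (E.smul_mem _ hx') (E.smul_mem _ hx)
        have hcc : c = c' := by
          by_contra hne
          exact hpE ((E.smul_mem_iff (sub_ne_zero.2 hne)).1 hmem)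
        subst hcc
        have := smul_right_injective V hc heq
        simp only [add_right_inj] at this
        rw [this]
    · rw [hd] at h; exact h.le
    · exact absurd (h p hpY) hp
end evx

section evx
variable {K V : Type*} [Field K] [Fintype K] [AddCommGroup V] [Module K V] [Finite V]

/-- A subspace that meets the set in the minimal number of points. -/
def EvxMin (f : V → ZMod 2) (W : Submodule K V) : Prop :=
  evxA f W = (Fintype.card K - 1) * evxm (Fintype.card K) (Module.finrank K W)

theorem evx_hyperplane {W Y : Submodule K V} {z : V} (hWY : W ≤ Y) (hz : z ∈ Y) (hzW : z ∉ W) :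
    ∃ H, W ≤ H ∧ H ≤ Y ∧ Module.finrank K H + 1 = Module.finrank K Y ∧ z ∉ H := by
  obtain ⟨φ, hφz, hφW⟩ := Submodule.exists_le_ker_of_notMem hzW
  have hzH : z ∉ LinearMap.ker φ ⊓ Y := fun h => hφz (LinearMap.mem_ker.1 h.1)
  refine ⟨LinearMap.ker φ ⊓ Y, le_inf hφW hWY, inf_le_right, ?_, hzH⟩
  have e : LinearMap.ker φ ⊓ Y ⊔ span K {z} = Y := by
   apply le_antisymm
   · exact sup_le inf_le_right (by rwa [span_singleton_le_iff_mem])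
   · intro y hy
     have : y = (y - (φ y * (φ z)⁻¹) • z) + (φ y * (φ z)⁻¹) • z := by simp
     rw [this]
     refine Submodule.add_mem_sup ⟨?_, Y.sub_mem hy (Y.smul_mem _ hz)⟩
       (Submodule.smul_mem _ _ (mem_span_singleton_self _))
     have hz' : φ z ≠ 0 := hφz
     simp [LinearMap.mem_ker, hz']
  rw [← evx_finrank_sup hzH, e]

theorem evx_subspace (W : Submodule K V) (k : ℕ) (hk : k ≤ Module.finrank K W) :
    ∃ T ≤ W, Module.finrank K T = k := by
  induction k with
  | zero => exact ⟨⊥, bot_le, finrank_bot K V⟩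
  | succ k ih =>
    obtain ⟨T, hT, hk'⟩ := ih (by omega)
    have hlt : T < W := lt_of_le_of_ne hT (by rintro rfl; omega)
    obtain ⟨x, hx, hxT⟩ := SetLike.exists_of_lt hlt
    exact ⟨T ⊔ span K {x}, sup_le hT (by rwa [span_singleton_le_iff_mem]), by
      rw [evx_finrank_sup hxT, hk']⟩

theorem evx_cover_min {f : V → ZMod 2} (hf : Evx K f) (hq : Even (Fintype.card K))
    {W Y : Submodule K V} (hWY : W ≤ Y) (hW3 : 3 ≤ Module.finrank K W)
    (hW : EvxMin f W) (hY : EvxMin f Y) {x : V} (hx : x ∈ Y) (hxW : x ∉ W) :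
    EvxMin f (W ⊔ Submodule.span K {x}) := by
  have hq2 : 2 ≤ Fintype.card K := evx_q_ge
  obtain ⟨e, he⟩ : ∃ e, Module.finrank K W = e + 3 := ⟨_, (Nat.sub_add_cancel hW3).symm⟩
  obtain ⟨j, hj⟩ : ∃ j, Module.finrank K Y = Module.finrank K W + j :=
    ⟨_, (Nat.add_sub_cancel' (Submodule.finrank_mono hWY)).symm⟩
  unfold EvxMin at *
  obtain ⟨p, hp⟩ : ∃ p, Fintype.card K = p + 1 := ⟨Fintype.card K - 1, by omega⟩
  rw [hj, he, show e + 3 + j = (e + j) + 3 by ring] at hY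
  rw [he] at hW
  simp only [evxm] at hW hY
  have hWne : ∃ y ∈ W, f y ≠ 0 := by
    by_contra hno
    push Not at hno
    have h0 := evxA_eq_zero.2 hno
    rw [h0] at hW
    have : 0 < (Fintype.card K - 1) * ((Fintype.card K + 2) * Fintype.card K ^ e) := by
      have : 0 < Fintype.card K - 1 := by omega
      positivity
    omega
  obtain ⟨y0, hy0, hfy0⟩ := hWne
  obtain ⟨r, hr⟩ : ∃ r, (p + 1) ^ j = r + 1 := ⟨(p + 1) ^ j - 1, by
    have : 1 ≤ (p + 1) ^ j := Nat.one_le_pow _ _ (by omega)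
    omega⟩
  have key := (evx_cover f W Y hWY ((Fintype.card K - 1) * (p * ((Fintype.card K + 2) * Fintype.card K ^ e)))
    ((Fintype.card K - 1) * (r * ((Fintype.card K + 2) * Fintype.card K ^ e))) j hj (by
      rw [hW, hY, pow_add, hp, hr]; ring) (by
      intro x hxY hxW
      have h1 := hf.lower hq (W ⊔ Submodule.span K {x}) ⟨y0, Submodule.mem_sup_left hy0, hfy0⟩
      rw [evx_finrank_sup hxW, he] at h1
      simp only [evxm] at h1
      refine le_trans (le_of_eq ?_) h1
      rw [hW, hp]; ring)).2 (by
      rw [hp, hr]; simp only [Nat.add_sub_cancel]; apply le_of_eq; ring) x hx hxW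
  rw [key, evx_finrank_sup hxW, he]
  simp only [evxm]
  rw [hW, hp]; ring

theorem evx_exists_min {f : V → ZMod 2} (hf : Evx K f) (hq : Even (Fintype.card K))
    {Y : Submodule K V} (hY3 : 4 ≤ Module.finrank K Y) (hY : EvxMin f Y) (i : ℕ)
    (hi1 : 1 ≤ i) (hi : i ≤ Module.finrank K Y) :
    ∃ W ≤ Y, Module.finrank K W = i ∧ EvxMin f W := by
  have hq2 : 2 ≤ Fintype.card K := evx_q_ge
  obtain ⟨p, hp⟩ : ∃ p, Fintype.card K = p + 1 := ⟨Fintype.card K - 1, by omega⟩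
  have hp1 : 1 ≤ p := by omega
  obtain ⟨k, hk⟩ : ∃ k, Module.finrank K Y = k + 4 := ⟨_, (Nat.sub_add_cancel hY3).symm⟩
  have hYA := hY
  unfold EvxMin at hYA
  rw [hk] at hYA
  simp only [evxm] at hYA
  induction i, hi1 using Nat.le_induction with
  | base =>
    have : ∃ y ∈ Y, f y ≠ 0 := by
      by_contra hno
      push Not at hno
      have h0 := evxA_eq_zero.2 hno
      rw [h0] at hYA
      have : 0 < (Fintype.card K - 1) * ((Fintype.card K + 2) * Fintype.card K ^ (k + 1)) := by
        have : 0 < Fintype.card K - 1 := by omega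
        positivity
      omega
    obtain ⟨y, hy, hfy⟩ := this
    have hy0 : y ≠ 0 := by rintro rfl; exact hfy hf.zero
    refine ⟨Submodule.span K {y}, by rwa [span_singleton_le_iff_mem], finrank_span_singleton hy0, ?_⟩
    unfold EvxMin
    rw [hf.span hfy, finrank_span_singleton hy0]; simp [evxm]
  | succ i hi1 ih =>
    obtain ⟨W, hWY, hWi, hW⟩ := ih (by omega)
    have hlt : W < Y := lt_of_le_of_ne hWY (by rintro rfl; omega)
    by_cases h3 : 3 ≤ i
    · obtain ⟨x, hx, hxW⟩ := SetLike.exists_of_lt hlt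
      exact ⟨_, sup_le hWY (by rwa [span_singleton_le_iff_mem]), by rw [evx_finrank_sup hxW, hWi],
        evx_cover_min hf hq hWY (by omega) hW hY hx hxW⟩
    · by_contra hno
      push Not at hno
      have hWne : ∃ y ∈ W, f y ≠ 0 := by
        by_contra hno
        push Not at hno
        have h0 := evxA_eq_zero.2 hno
        unfold EvxMin at hW
        rw [h0, hWi] at hW
        have h1 : 0 < Fintype.card K - 1 := by omega
        have h2 : 0 < evxm (Fintype.card K) i := by
          obtain rfl | rfl : i = 1 ∨ i = 2 := by omega
          all_goals simp [evxm]
        have := Nat.mul_pos h1 h2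
        omega
      obtain ⟨y0, hy0, hfy0⟩ := hWne
      have hstep : ∀ x ∈ Y, x ∉ W → (Fintype.card K - 1) * (evxm (Fintype.card K) (i + 1) + 1) ≤
          evxA f (W ⊔ Submodule.span K {x}) := by
        intro x hx hxW
        have h1 := hf.lower hq (W ⊔ Submodule.span K {x}) ⟨y0, Submodule.mem_sup_left hy0, hfy0⟩
        have h2 := hno _ (sup_le hWY (by rwa [span_singleton_le_iff_mem]))
          (by rw [evx_finrank_sup hxW, hWi])
        unfold EvxMin at h2
        rw [evx_finrank_sup hxW, hWi] at h1 h2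
        obtain ⟨c, hc⟩ := hf.dvd (W ⊔ Submodule.span K {x})
        rw [hc] at h1 h2 ⊢
        have hpos : 0 < Fintype.card K - 1 := by omega
        have h3 := Nat.le_of_mul_le_mul_left h1 hpos
        have h4 : c ≠ evxm (Fintype.card K) (i + 1) := by rintro rfl; exact h2 rfl
        exact Nat.mul_le_mul_left _ (by omega)
      have hpk : 1 ≤ (p + 1) ^ k := Nat.one_le_pow _ _ (by omega)
      unfold EvxMin at hW
      obtain rfl | rfl : i = 1 ∨ i = 2 := by omega
      · rw [hWi] at hW
        simp only [evxm] at hW hstep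
        obtain ⟨r, hr⟩ : ∃ r, (p + 3) * (p + 1) ^ (k + 1) = r + 1 := ⟨(p + 3) * (p + 1) ^ (k + 1) - 1, by
          have : 0 < (p + 3) * (p + 1) ^ (k + 1) := by positivity
          omega⟩
        have h1 := (evx_cover f W Y hWY (p * 2) (p * r) (k + 3) (by omega) (by
          rw [hW, hYA, hp, show p + 1 + 2 = p + 3 by ring, hr]; simp only [Nat.add_sub_cancel]; ring) (by
          intro x hx hxW
          refine le_trans (le_of_eq ?_) (hstep x hx hxW)
          rw [hW, hp]; simp only [Nat.add_sub_cancel]; ring)).1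
        rw [hp] at h1
        simp only [Nat.add_sub_cancel] at h1
        have h2 : ((p + 1) ^ (k + 3) - 1) * 2 ≤ p * r := by
          refine le_of_mul_le_mul_left (a := p) ?_ hp1
          calc _ = ((p + 1) ^ (k + 3) - 1) * (p * 2) := by ring
            _ ≤ _ := h1
            _ = _ := by ring
        rw [Nat.sub_mul] at h2
        have h3 : (p + 1) ^ (k + 3) * 2 ≤ p * r + 2 := by omega
        rw [show (p + 1) ^ (k + 3) = (p + 1) ^ k * (p + 1) ^ 3 by ring] at h3
        rw [show (p + 1) ^ (k + 1) = (p + 1) ^ k * (p + 1) by ring] at hr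
        generalize (p + 1) ^ k = Q at *
        have h4 : p * ((p + 3) * (Q * (p + 1))) = p * r + p := by rw [hr]; ring
        have h5 : Q * (p * (p + 3) * (p + 1)) + 2 < Q * ((p + 1) ^ 3 * 2) + p := by
          have : p * (p + 3) * (p + 1) + 2 ≤ (p + 1) ^ 3 * 2 := by nlinarith [Nat.zero_le (p ^ 3)]
          nlinarith
        nlinarith
      · rw [hWi] at hW
        simp only [evxm] at hW hstep
        obtain ⟨r, hr⟩ : ∃ r, (p + 3) * (p + 1) ^ (k + 1) = r + 2 := ⟨(p + 3) * (p + 1) ^ (k + 1) - 2, by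
          have h1 : 1 ≤ (p + 1) ^ (k + 1) := Nat.one_le_pow _ _ (by omega)
          have : (p + 3) * 1 ≤ (p + 3) * (p + 1) ^ (k + 1) := Nat.mul_le_mul_left _ h1
          omega⟩
        have h1 := (evx_cover f W Y hWY (p * (p + 2)) (p * r) (k + 2) (by omega) (by
          rw [hW, hYA, hp, show p + 1 + 2 = p + 3 by ring, hr]; simp only [Nat.add_sub_cancel]; ring) (by
          intro x hx hxW
          refine le_trans (le_of_eq ?_) (hstep x hx hxW)
          rw [hW, hp]; simp only [Nat.add_sub_cancel]; ring)).1
        rw [hp] at h1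
        simp only [Nat.add_sub_cancel] at h1
        have h2 : ((p + 1) ^ (k + 2) - 1) * (p + 2) ≤ p * r := by
          refine le_of_mul_le_mul_left (a := p) ?_ hp1
          calc _ = ((p + 1) ^ (k + 2) - 1) * (p * (p + 2)) := by ring
            _ ≤ _ := h1
            _ = _ := by ring
        rw [Nat.sub_mul] at h2
        have h3 : (p + 1) ^ (k + 2) * (p + 2) ≤ p * r + (p + 2) := by omega
        rw [show (p + 1) ^ (k + 2) = (p + 1) ^ k * (p + 1) ^ 2 by ring] at h3
        rw [show (p + 1) ^ (k + 1) = (p + 1) ^ k * (p + 1) by ring] at hr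
        generalize (p + 1) ^ k = Q at *
        have h4 : p * ((p + 3) * (Q * (p + 1))) = p * r + 2 * p := by rw [hr]; ring
        have h5 : Q * (p * (p + 3) * (p + 1)) + (p + 2) < Q * ((p + 1) ^ 2 * (p + 2)) + 2 * p := by
          have : p * (p + 3) * (p + 1) + (2 * p + 2) = (p + 1) ^ 2 * (p + 2) := by ring
          rw [← this]
          nlinarith
        nlinarith

theorem evx_compl {f : V → ZMod 2} {H T C : Submodule K V} (hCT : C ⊓ T = ⊥) (hsup : C ⊔ T = H)
    (hper : ∀ v ∈ T, ∀ x ∈ H, f (x + v) = f x) (hT : Module.finrank K T + 3 = Module.finrank K H)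
    (hH : EvxMin f H) :
    Module.finrank K C = 3 ∧ evxA f C = (Fintype.card K - 1) * (Fintype.card K + 2) := by
  have hq2 : 2 ≤ Fintype.card K := evx_q_ge
  constructor
  · have := Submodule.finrank_sup_add_finrank_inf_eq C T
    rw [hsup, hCT, finrank_bot] at this
    omega
  · have h1 := evx_periods (f := f) C T hCT (fun v hv x hx => hper v hv x (hsup ▸ Submodule.mem_sup_left hx))
    rw [hsup, hH, ← hT] at h1
    simp only [evxm] at h1
    have : 0 < Fintype.card K ^ Module.finrank K T := by positivity
    refine (Nat.eq_of_mul_eq_mul_left this ?_).symm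
    rw [← h1]; ring

theorem Evx.line_le {f : V → ZMod 2} (hf : Evx K f) {H T L : Submodule K V} (hTH : T ≤ H) (hLH : L ≤ H)
    (hper : ∀ v ∈ T, ∀ x ∈ H, f (x + v) = f x) (hT : Module.finrank K T + 3 = Module.finrank K H)
    (hH : EvxMin f H) (hL : Module.finrank K L = 2) (hLT : L ⊓ T = ⊥) :
    evxA f L ≤ 2 * (Fintype.card K - 1) := by
  obtain ⟨C', hLC, hC'⟩ := (disjoint_iff.2 hLT).exists_isCompl
  have h1 : (C' ⊓ H) ⊓ T = ⊥ := by
    rw [eq_bot_iff, ← hC'.inf_eq_bot]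
    exact inf_le_inf_right _ inf_le_left
  have h2 : (C' ⊓ H) ⊔ T = H := by
    rw [sup_comm, inf_comm, inf_comm H, ← sup_inf_assoc_of_le C' hTH, sup_comm, hC'.sup_eq_top, top_inf_eq]
  obtain ⟨h3, h4⟩ := evx_compl h1 h2 hper hT hH
  exact hf.hyperoval (C' ⊓ H) L (le_inf hLC hLH) h3 hL h4
end evx

section evx
variable {K V : Type*} [Field K] [Fintype K] [AddCommGroup V] [Module K V] [Finite V]

theorem evx_span_le (x : V) : Module.finrank K ↥(span K {x}) ≤ 1 := by
  by_cases h : x = 0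
  · rw [h, Submodule.span_zero_singleton, finrank_bot]; omega
  · rw [finrank_span_singleton h]

/-- `T` consists of periods of `f` on `Y`. -/
def EvxPer (f : V → ZMod 2) (T Y : Submodule K V) : Prop := ∀ v ∈ T, ∀ x ∈ Y, f (x + v) = f x

theorem EvxPer.zero_on {f : V → ZMod 2} (hf : Evx K f) {T Y : Submodule K V} (h : EvxPer f T Y)
    {v : V} (hv : v ∈ T) : f v = 0 := by
  have := h v hv 0 Y.zero_mem
  rwa [zero_add, hf.zero] at this

theorem EvxMin.exists_ne {f : V → ZMod 2} {Y : Submodule K V} (h : EvxMin f Y) : ∃ y ∈ Y, f y ≠ 0 := by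
  have hq2 : 2 ≤ Fintype.card K := evx_q_ge
  by_contra hno
  push Not at hno
  have h0 := evxA_eq_zero.2 hno
  unfold EvxMin at h
  rw [h0] at h
  have h1 : 0 < Fintype.card K - 1 := by omega
  have h2 : 0 < evxm (Fintype.card K) (Module.finrank K Y) := by
    rcases Module.finrank K Y with _ | _ | _ | d
    all_goals simp only [evxm]
    all_goals positivity
  have := Nat.mul_pos h1 h2
  omega

theorem EvxMin.empty {f : V → ZMod 2} (hf : Evx K f) (hq : Even (Fintype.card K)) {Y : Submodule K V}
    (hd : 3 ≤ Module.finrank K Y) (h : EvxMin f Y) :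
    ∃ E ≤ Y, Module.finrank K E + 1 = Module.finrank K Y ∧ ∀ x ∈ E, f x = 0 := by
  rcases evx_empty_hyperplane hf Y hd (fun W _ hW => hf.lower hq W hW) with h1 | h1 | h1
  · exact h1
  · unfold EvxMin at h; omega
  · obtain ⟨y, hy, hfy⟩ := h.exists_ne
    exact absurd (h1 y hy) hfy

theorem evx_transfer {f : V → ZMod 2} (hf : Evx K f) (hq : Even (Fintype.card K)) {d : ℕ} (hd : 4 ≤ d)
    {Y H H' T : Submodule K V} (hY : EvxMin f Y) (hYd : Module.finrank K Y = d + 1)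
    (hHY : H ≤ Y) (hHd : Module.finrank K H = d) (hH : EvxMin f H) (hTH : T ≤ H) (hper : EvxPer f T H)
    (hH'Y : H' ≤ Y) (hH'd : Module.finrank K H' = d) {v : V} (hv : v ∈ T) (hvH' : v ∉ H') :
    EvxMin f H' := by
  obtain ⟨e, rfl⟩ : ∃ e, d = e + 4 := ⟨d - 4, by omega⟩
  have hvU : v ∉ H ⊓ H' := fun h => hvH' h.2
  have hv0 : v ≠ 0 := by rintro rfl; exact hvH' H'.zero_mem
  have h1 := Submodule.finrank_sup_add_finrank_inf_eq H H'
  have h2 := Submodule.finrank_mono (sup_le hHY hH'Y)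
  have h3 := evx_finrank_sup hvU
  have hle : H ⊓ H' ⊔ span K {v} ≤ H :=
    sup_le inf_le_left (by rw [span_singleton_le_iff_mem]; exact hTH hv)
  have h4 := Submodule.finrank_mono hle
  have hU : Module.finrank K ↥(H ⊓ H') = e + 3 := by omega
  have hsup : H ⊓ H' ⊔ span K {v} = H := Submodule.eq_of_le_of_finrank_eq hle (by omega)
  have hinf : H ⊓ H' ⊓ span K {v} = ⊥ := by
    have h5 := Submodule.finrank_sup_add_finrank_inf_eq (H ⊓ H') (span K {v})
    rw [finrank_span_singleton hv0, h3] at h5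
    exact Submodule.finrank_eq_zero.1 (by omega)
  have h6 := evx_periods (f := f) (H ⊓ H') (span K {v}) hinf (fun w hw x hx =>
    hper w ((span_singleton_le_iff_mem v T).2 hv hw) x hx.1)
  rw [hsup, finrank_span_singleton hv0, pow_one] at h6
  have hUmin : EvxMin f (H ⊓ H') := by
    unfold EvxMin at hH ⊢
    rw [hHd] at hH
    rw [hU]
    simp only [evxm] at hH ⊢
    have : 0 < Fintype.card K := by have : 2 ≤ Fintype.card K := evx_q_ge; omega
    refine Nat.eq_of_mul_eq_mul_left this ?_
    rw [← h6, hH]; ring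
  have hlt : H ⊓ H' < H' := lt_of_le_of_ne inf_le_right (by intro h; rw [h] at hU; omega)
  obtain ⟨x, hx, hxU⟩ := SetLike.exists_of_lt hlt
  have h7 := evx_cover_min hf hq (inf_le_left.trans hHY) (by omega) hUmin hY (hH'Y hx) hxU
  have h8 : H ⊓ H' ⊔ span K {x} = H' := Submodule.eq_of_le_of_finrank_eq
    (sup_le inf_le_right (by rwa [span_singleton_le_iff_mem])) (by rw [evx_finrank_sup hxU]; omega)
  rwa [h8] at h7

/-- A period on a minimal hyperplane `H` is a period on every minimal hyperplane `H'` that contains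
it together with a point of the support in `H`. -/
theorem evx_line_period {f : V → ZMod 2} (hf : Evx K f) (hq3 : 3 ≤ Fintype.card K)
    {H T H' T' : Submodule K V} (hTH : T ≤ H) (hper : EvxPer f T H) (hH' : EvxMin f H')
    (hTH' : T' ≤ H') (hper' : EvxPer f T' H') (hT' : Module.finrank K T' + 3 = Module.finrank K H')
    {y v : V} (hv : v ∈ T) (hvH' : v ∈ H') (hy : y ∈ H) (hyH' : y ∈ H') (hfy : f y ≠ 0) : v ∈ T' := by
  by_contra hvT'
  have hv0 : v ≠ 0 := by rintro rfl; exact hvT' T'.zero_mem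
  have hfv := hper.zero_on hf hv
  have hvy : v ∉ Submodule.span K {y} := by
    intro h
    obtain ⟨c, rfl⟩ := mem_span_singleton.1 h
    have hc : c ≠ 0 := by rintro rfl; simp at hv0
    rw [hf.smul c y hc] at hfv
    exact hfy hfv
  have hy0 : y ≠ 0 := by rintro rfl; exact hfy hf.zero
  have hL : Module.finrank K ↥(Submodule.span K {y} ⊔ Submodule.span K {v}) = 2 := by
    rw [evx_finrank_sup hvy, finrank_span_singleton hy0]
  have hdis : Submodule.span K {y} ⊓ Submodule.span K {v} = ⊥ := by
    have h5 := Submodule.finrank_sup_add_finrank_inf_eq (Submodule.span K {y}) (Submodule.span K {v})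
    rw [finrank_span_singleton hv0, finrank_span_singleton hy0, hL] at h5
    exact Submodule.finrank_eq_zero.1 (by omega)
  have hyH2 : Submodule.span K {y} ≤ H := (span_singleton_le_iff_mem y H).2 hy
  have hA := evx_periods (f := f) (Submodule.span K {y}) (Submodule.span K {v}) hdis (fun w hw x hx =>
    hper w ((span_singleton_le_iff_mem v T).2 hv hw) x (hyH2 hx))
  rw [hf.span hfy, finrank_span_singleton hv0, pow_one] at hA
  have hLT : (Submodule.span K {y} ⊔ Submodule.span K {v}) ⊓ T' = ⊥ := by
    rw [eq_bot_iff]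
    rintro w ⟨hw, hwT⟩
    obtain ⟨a, ha, b, hb, rfl⟩ := Submodule.mem_sup.1 hw
    have h1 : f (a + b) = f a := hper b ((span_singleton_le_iff_mem v T).2 hv hb) a (hyH2 ha)
    have h2 : f (a + b) = 0 := hper'.zero_on hf hwT
    obtain ⟨c, rfl⟩ := mem_span_singleton.1 ha
    obtain ⟨e, rfl⟩ := mem_span_singleton.1 hb
    have hc : c = 0 := by
      by_contra hc
      rw [hf.smul c y hc] at h1
      exact hfy (h1.symm.trans h2)
    subst hc
    have he : e = 0 := by
      by_contra he
      apply hvT'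
      have := T'.smul_mem e⁻¹ hwT
      simpa [he] using this
    subst he
    simp
  have := hf.line_le hTH' (sup_le ((span_singleton_le_iff_mem y H').2 hyH')
    ((span_singleton_le_iff_mem v H').2 hvH')) hper' hT' hH' hL hLT
  rw [hA] at this
  have h2 := Nat.le_of_mul_le_mul_right this (by omega : 0 < Fintype.card K - 1)
  omega

theorem evx_extend {f : V → ZMod 2} (hf : Evx K f) (hq3 : 3 ≤ Fintype.card K)
    {d : ℕ} (hd : 4 ≤ d)
    (ih : ∀ H : Submodule K V, Module.finrank K H = d → EvxMin f H →
      ∃ T ≤ H, Module.finrank K T + 3 = d ∧ EvxPer f T H)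
    {Y Z H T : Submodule K V} (hYd : Module.finrank K Y = d + 1)
    (hZY : Z ≤ Y) (hZ2 : 2 ≤ Module.finrank K Z) (hZ0 : ∀ x ∈ Z, f x = 0)
    (hZ : ∀ H' ≤ Y, Module.finrank K H' = d → ¬ Z ≤ H' → EvxMin f H')
    (hHY : H ≤ Y) (hHd : Module.finrank K H = d) (hH : EvxMin f H) (hTH : T ≤ H) (hper : EvxPer f T H) :
    EvxPer f T Y := by
  have key : ∀ v ∈ T, ∀ x ∈ Y, f x ≠ 0 → f (x + v) = f x := by
    intro v hv x hx hfx
    obtain ⟨y, hyH, hfy, hyZ⟩ : ∃ y ∈ H, f y ≠ 0 ∧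
        ¬ Z ≤ (Submodule.span K {v} ⊔ Submodule.span K {x}) ⊔ Submodule.span K {y} := by
      by_contra hno
      push Not at hno
      obtain ⟨y1, hy1, hfy1⟩ := hH.exists_ne
      have hd1 : Module.finrank K ↥((Submodule.span K {v} ⊔ Submodule.span K {x}) ⊔ Submodule.span K {y1}) ≤ 3 := by
        have a1 := Submodule.finrank_add_le_finrank_add_finrank
          (Submodule.span K {v} ⊔ Submodule.span K {x}) (Submodule.span K {y1})
        have a2 := Submodule.finrank_add_le_finrank_add_finrank (Submodule.span K {v}) (Submodule.span K {x})
        have a3 := evx_span_le (K := K) v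
        have a4 := evx_span_le (K := K) x
        have a5 := evx_span_le (K := K) y1
        omega
      obtain ⟨y2, hy2, hfy2, hy2n⟩ : ∃ y ∈ H, f y ≠ 0 ∧
          y ∉ (Submodule.span K {v} ⊔ Submodule.span K {x}) ⊔ Submodule.span K {y1} := by
        by_contra hno2
        push Not at hno2
        have h1 : evxA f H ≤ (((Submodule.span K {v} ⊔ Submodule.span K {x}) ⊔ Submodule.span K {y1} :
            Submodule K V) : Set V).ncard :=
          Set.ncard_le_ncard (fun y hy => hno2 y hy.1 hy.2) (Set.toFinite _)
        rw [evx_card, hH, hHd] at h1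
        obtain ⟨e, rfl⟩ : ∃ e, d = e + 4 := ⟨d - 4, by omega⟩
        simp only [evxm] at h1
        have h2 := h1.trans (Nat.pow_le_pow_right (by omega) hd1)
        obtain ⟨p, hp⟩ : ∃ p, Fintype.card K = p + 1 := ⟨Fintype.card K - 1, by omega⟩
        rw [hp] at h2
        simp only [Nat.add_sub_cancel] at h2
        have h3 : p + 1 ≤ (p + 1) ^ (e + 1) := Nat.le_self_pow (by omega) _
        have h4 : p * ((p + 1 + 2) * (p + 1)) ≤ p * ((p + 1 + 2) * (p + 1) ^ (e + 1)) :=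
          Nat.mul_le_mul_left _ (Nat.mul_le_mul_left _ h3)
        nlinarith
      have hz1 := hno y1 hy1 hfy1
      have hz2 := hno y2 hy2 hfy2
      have hzle : Z ≤ Submodule.span K {v} ⊔ Submodule.span K {x} := by
        intro z hz
        by_contra hzn
        apply hy2n
        have h1 := evx_exchange hzn (hz2 hz)
        exact sup_le le_sup_left ((span_singleton_le_iff_mem _ _).2 (hz1 hz)) h1
      have hfr : Module.finrank K ↥(Submodule.span K {v} ⊔ Submodule.span K {x}) ≤ 2 := by
        have a2 := Submodule.finrank_add_le_finrank_add_finrank (Submodule.span K {v}) (Submodule.span K {x})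
        have a3 := evx_span_le (K := K) v
        have a4 := evx_span_le (K := K) x
        omega
      have hzeq := Submodule.eq_of_le_of_finrank_le hzle (by omega)
      apply hfx
      apply hZ0
      rw [hzeq]
      exact Submodule.mem_sup_right (mem_span_singleton_self _)
    obtain ⟨z, hz, hzn⟩ := SetLike.not_le_iff_exists.1 hyZ
    obtain ⟨H', hWH', hH'Y, hH'd, hzH'⟩ := evx_hyperplane
      (sup_le (sup_le ((span_singleton_le_iff_mem _ _).2 (hHY (hTH hv)))
        ((span_singleton_le_iff_mem _ _).2 hx)) ((span_singleton_le_iff_mem _ _).2 (hHY hyH)))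
      (hZY hz) hzn
    have hH'd2 : Module.finrank K H' = d := by omega
    have hH' := hZ H' hH'Y hH'd2 (fun h => hzH' (h hz))
    obtain ⟨T', hT'H', hT'd, hper'⟩ := ih H' hH'd2 hH'
    have hvH' : v ∈ H' := hWH' (Submodule.mem_sup_left (Submodule.mem_sup_left (mem_span_singleton_self _)))
    have hxH' : x ∈ H' := hWH' (Submodule.mem_sup_left (Submodule.mem_sup_right (mem_span_singleton_self _)))
    have hyH' : y ∈ H' := hWH' (Submodule.mem_sup_right (mem_span_singleton_self _))
    have hvT' := evx_line_period hf hq3 hTH hper hH' hT'H' hper' (by omega) hv hvH' hyH hyH' hfy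
    exact hper' v hvT' x hxH'
  intro v hv x hx
  by_cases hfx : f x = 0
  · by_contra hne
    rw [hfx] at hne
    have := key (-v) (T.neg_mem hv) (x + v) (Y.add_mem hx (hHY (hTH hv))) hne
    rw [add_neg_cancel_right] at this
    exact hne (this.symm.trans hfx)
  · exact key v hv x hx hfx

theorem evx_step {f : V → ZMod 2} (hf : Evx K f) (hq : Even (Fintype.card K))
    {d : ℕ} (hd : 4 ≤ d)
    (ih : ∀ H : Submodule K V, Module.finrank K H = d → EvxMin f H →
      ∃ T ≤ H, Module.finrank K T + 3 = d ∧ EvxPer f T H)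
    {Y : Submodule K V} (hYd : Module.finrank K Y = d + 1) (hY : EvxMin f Y) :
    ∃ T ≤ Y, Module.finrank K T + 3 = d + 1 ∧ EvxPer f T Y := by
  have hq2 : 2 ≤ Fintype.card K := evx_q_ge
  obtain ⟨E, hEY, hEd, hE0⟩ := hY.empty hf hq (by omega)
  by_cases hq3 : 3 ≤ Fintype.card K
  · obtain ⟨H0, hH0Y, hH0d, hH0⟩ := evx_exists_min hf hq (by omega) hY d (by omega) (by omega)
    obtain ⟨T0, hT0H, hT0d, hper0⟩ := ih H0 hH0d hH0
    have hT0ne : T0 ≠ ⊥ := by rintro rfl; rw [finrank_bot] at hT0d; omega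
    obtain ⟨v0, hv0, hv00⟩ := Submodule.exists_mem_ne_zero_of_ne_bot hT0ne
    obtain ⟨H1, -, hH1Y, hH1d, hv0H1⟩ := evx_hyperplane (W := ⊥) (Y := Y) bot_le (hH0Y (hT0H hv0))
      (by simpa using hv00)
    have hH1 : EvxMin f H1 := evx_transfer hf hq hd hY hYd hH0Y hH0d hH0 hT0H hper0 hH1Y (by omega) hv0 hv0H1
    obtain ⟨T1, hT1H, hT1d, hper1⟩ := ih H1 (by omega) hH1
    have hv0T1 : v0 ∉ T1 := fun h => hv0H1 (hT1H h)
    have hZd : d - 2 ≤ Module.finrank K ↥(T0 ⊔ T1) := by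
      have h1 := evx_finrank_sup hv0T1
      have h2 : T1 ⊔ span K {v0} ≤ T0 ⊔ T1 :=
        sup_le le_sup_right ((span_singleton_le_iff_mem _ _).2 (Submodule.mem_sup_left hv0))
      have h3 := Submodule.finrank_mono h2
      omega
    have hZY : T0 ⊔ T1 ≤ Y := sup_le (hT0H.trans hH0Y) (hT1H.trans hH1Y)
    have hZ : ∀ H' ≤ Y, Module.finrank K H' = d → ¬ (T0 ⊔ T1) ≤ H' → EvxMin f H' := by
      intro H' hH'Y hH'd hn
      by_cases h0 : T0 ≤ H'
      · have h1 : ¬ T1 ≤ H' := fun h => hn (sup_le h0 h)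
        obtain ⟨v, hv, hvn⟩ := SetLike.not_le_iff_exists.1 h1
        exact evx_transfer hf hq hd hY hYd hH1Y (by omega) hH1 hT1H hper1 hH'Y hH'd hv hvn
      · obtain ⟨v, hv, hvn⟩ := SetLike.not_le_iff_exists.1 h0
        exact evx_transfer hf hq hd hY hYd hH0Y hH0d hH0 hT0H hper0 hH'Y hH'd hv hvn
    have hZE : T0 ⊔ T1 ≤ E := by
      by_contra hn
      obtain ⟨y, hy, hfy⟩ := (hZ E hEY (by omega) hn).exists_ne
      exact hfy (hE0 y hy)
    have hZ0 : ∀ x ∈ T0 ⊔ T1, f x = 0 := fun x hx => hE0 x (hZE hx)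
    have p0 := evx_extend hf hq3 hd ih hYd hZY (by omega) hZ0 hZ hH0Y hH0d hH0 hT0H hper0
    have p1 := evx_extend hf hq3 hd ih hYd hZY (by omega) hZ0 hZ hH1Y (by omega) hH1 hT1H hper1
    have pZ : EvxPer f (T0 ⊔ T1) Y := by
      intro v hv x hx
      obtain ⟨a, ha, b, hb, rfl⟩ := Submodule.mem_sup.1 hv
      rw [← add_assoc, p1 b hb (x + a) (Y.add_mem hx (hH0Y (hT0H ha))), p0 a ha x hx]
    obtain ⟨T, hT, hTd⟩ := evx_subspace (T0 ⊔ T1) (d - 2) hZd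
    exact ⟨T, hT.trans hZY, by omega, fun v hv => pZ v (hT hv)⟩
  · have hq' : Fintype.card K = 2 := by omega
    have hsub : {x | x ∈ Y ∧ f x ≠ 0} ⊆ (Y : Set V) \ (E : Set V) := fun x hx =>
      ⟨hx.1, fun h => hx.2 (hE0 x h)⟩
    have heq : {x | x ∈ Y ∧ f x ≠ 0} = (Y : Set V) \ (E : Set V) := by
      apply Set.eq_of_subset_of_ncard_le hsub _ (Set.toFinite _)
      rw [Set.ncard_sdiff (by exact_mod_cast hEY) (Set.toFinite _), evx_card, evx_card]
      have h1 : evxA f Y = _ := hY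
      unfold evxA at h1
      rw [h1, hq', hYd, show Module.finrank K E = d by omega]
      obtain ⟨e, rfl⟩ : ∃ e, d = e + 4 := ⟨d - 4, by omega⟩
      simp only [evxm]
      have : 2 ^ (e + 4 + 1) = 32 * 2 ^ e := by ring
      have h2 : 2 ^ (e + 4) = 16 * 2 ^ e := by ring
      have h3 : 2 ^ (e + 2) = 4 * 2 ^ e := by ring
      rw [this, h2, h3]
      omega
    have hiff : ∀ x ∈ Y, (f x ≠ 0 ↔ x ∉ E) := by
      intro x hx
      have := Set.ext_iff.1 heq x
      simp only [Set.mem_ofPred_eq, Set.mem_sdiff, SetLike.mem_coe, hx, true_and] at this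
      exact this
    obtain ⟨T, hT, hTd⟩ := evx_subspace E (d - 2) (by omega)
    refine ⟨T, hT.trans hEY, by omega, fun v hv x hx => ?_⟩
    have h1 := hiff x hx
    have h2 := hiff (x + v) (Y.add_mem hx (hEY (hT hv)))
    rw [E.add_mem_iff_left (hT hv), ← h1] at h2
    by_cases hfx : f x = 0
    · rw [hfx]
      by_contra h
      exact h2.1 h hfx
    · rw [evx_ne_zero.1 hfx, evx_ne_zero.1 (h2.2 hfx)]

theorem evx_structure {f : V → ZMod 2} (hf : Evx K f) (hq : Even (Fintype.card K))
    (base : ∀ H : Submodule K V, Module.finrank K H = 4 → EvxMin f H →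
      ∃ T ≤ H, Module.finrank K T + 3 = 4 ∧ EvxPer f T H)
    (d : ℕ) (hd : 4 ≤ d) : ∀ Y : Submodule K V, Module.finrank K Y = d → EvxMin f Y →
    ∃ T ≤ Y, Module.finrank K T + 3 = d ∧ EvxPer f T Y := by
  induction d, hd using Nat.le_induction with
  | base => exact base
  | succ d hd ih => exact fun Y hYd hY => evx_step hf hq hd ih hYd hY
end evx

section evx
variable {K V : Type*} [Field K] [Fintype K] [AddCommGroup V] [Module K V] [Finite V]

/-- Number of points of the support in a subspace. -/
noncomputable def evxN (f : V → ZMod 2) (W : Submodule K V) : ℕ :=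
  ((fun x => span K {x}) '' {x | x ∈ W ∧ f x ≠ 0}).ncard

theorem evxA_eq {f : V → ZMod 2} (h0 : f 0 = 0) (hs : ∀ (c : K) (x : V), c ≠ 0 → f (c • x) = f x)
    (W : Submodule K V) : evxA f W = (Fintype.card K - 1) * evxN f W := by
  refine evx_points (K := K) {x | x ∈ W ∧ f x ≠ 0} ?_ ?_
  · simp [h0]
  · rintro c x hc ⟨h1, h2⟩
    exact ⟨W.smul_mem _ h1, by rwa [hs c x hc]⟩

theorem evx_odd_cast (hq : Even (Fintype.card K)) : ((Fintype.card K - 1 : ℕ) : ZMod 2) = 1 := by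
  have hq2 : 2 ≤ Fintype.card K := evx_q_ge
  have h1 : ((Fintype.card K : ℕ) : ZMod 2) = 0 := by rwa [ZMod.natCast_eq_zero_iff_even]
  rw [Nat.cast_sub (by omega), h1]
  decide

theorem evx_sum_smul (hq : Even (Fintype.card K)) {f : V → ZMod 2} (h0 : f 0 = 0)
    (hs : ∀ (c : K) (x : V), c ≠ 0 → f (c • x) = f x) (b : V) : ∑ t : K, f (t • b) = f b := by
  classical
  rw [← Finset.add_sum_erase _ _ (Finset.mem_univ (0 : K)), zero_smul, h0, zero_add,
    Finset.sum_congr rfl (fun t ht => hs t b (Finset.ne_of_mem_erase ht)), Finset.sum_const,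
    Finset.card_erase_of_mem (Finset.mem_univ _), Finset.card_univ, nsmul_eq_mul, evx_odd_cast hq, one_mul]

theorem evx_line_cast (hq : Even (Fintype.card K)) {f : V → ZMod 2} (h0 : f 0 = 0)
    (hs : ∀ (c : K) (x : V), c ≠ 0 → f (c • x) = f x) {a b : V} (hb : b ≠ 0) (ha : a ∉ span K {b}) :
    ((evxN f (span K {b} ⊔ span K {a}) : ℕ) : ZMod 2) = ∑ t : K, f (a + t • b) + f b := by
  classical
  have hA := congrArg (Nat.cast : ℕ → ZMod 2) (evxA_eq h0 hs (span K {b} ⊔ span K {a}))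
  rw [Nat.cast_mul, evx_odd_cast hq, one_mul] at hA
  rw [← hA]
  have hinj : Function.Injective (fun z : K × K => z.1 • a + z.2 • b) := by
    rintro ⟨s, t⟩ ⟨s', t'⟩ h
    simp only at h
    have h1 : (s - s') • a = (t' - t) • b := by
      rw [sub_smul, sub_smul, sub_eq_sub_iff_add_eq_add, h, add_comm]
    have h2 : s = s' := by
      by_contra hne
      apply ha
      rw [mem_span_singleton]
      refine ⟨(s - s')⁻¹ * (t' - t), ?_⟩
      rw [mul_smul, ← h1, smul_smul, inv_mul_cancel₀ (sub_ne_zero.2 hne), one_smul]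
    subst h2
    rw [sub_self, zero_smul] at h1
    have h3 := (smul_eq_zero.1 h1.symm).resolve_right hb
    rw [sub_eq_zero.1 h3]
  have hset : {x | x ∈ span K {b} ⊔ span K {a} ∧ f x ≠ 0} =
      (fun z : K × K => z.1 • a + z.2 • b) '' {z | f (z.1 • a + z.2 • b) ≠ 0} := by
    ext x
    constructor
    · rintro ⟨hx, hfx⟩
      obtain ⟨y, hy, z, hz, rfl⟩ := Submodule.mem_sup.1 hx
      obtain ⟨t, rfl⟩ := mem_span_singleton.1 hy
      obtain ⟨s, rfl⟩ := mem_span_singleton.1 hz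
      rw [add_comm] at hfx ⊢
      exact ⟨(s, t), hfx, rfl⟩
    · rintro ⟨⟨s, t⟩, hz, rfl⟩
      refine ⟨?_, hz⟩
      exact Submodule.add_mem _ (Submodule.mem_sup_right (mem_span_singleton.2 ⟨s, rfl⟩))
        (Submodule.mem_sup_left (mem_span_singleton.2 ⟨t, rfl⟩))
  unfold evxA
  rw [hset, Set.ncard_image_of_injective _ hinj]
  have hc : {z : K × K | f (z.1 • a + z.2 • b) ≠ 0}.ncard =
      (Finset.univ.filter (fun z : K × K => f (z.1 • a + z.2 • b) ≠ 0)).card := by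
    rw [← Set.ncard_coe_finset]; simp
  rw [hc, Finset.card_filter, Nat.cast_sum]
  have h1 : ∀ z : K × K, ((if f (z.1 • a + z.2 • b) ≠ 0 then 1 else 0 : ℕ) : ZMod 2) =
      f (z.1 • a + z.2 • b) := by
    intro z
    generalize f (z.1 • a + z.2 • b) = c
    revert c; decide
  rw [Finset.sum_congr rfl (fun z _ => h1 z), Fintype.sum_prod_type]
  simp only
  rw [← Finset.add_sum_erase _ _ (Finset.mem_univ (0 : K))]
  simp only [zero_smul, zero_add]
  rw [evx_sum_smul hq h0 hs b, add_comm]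
  congr 1
  have h2 : ∀ s ∈ Finset.univ.erase (0 : K), ∑ t : K, f (s • a + t • b) = ∑ t : K, f (a + t • b) := by
    intro s hs0
    have hs0 := Finset.ne_of_mem_erase hs0
    rw [← Equiv.sum_comp (Equiv.mulLeft₀ s hs0) (fun t => f (s • a + t • b))]
    refine Finset.sum_congr rfl (fun t _ => ?_)
    rw [← hs s (a + t • b) hs0, smul_add, smul_smul]
    rfl
  rw [Finset.sum_congr rfl h2, Finset.sum_const,
    Finset.card_erase_of_mem (Finset.mem_univ _), Finset.card_univ, nsmul_eq_mul, evx_odd_cast hq, one_mul]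

theorem evx_of_even (hq : Even (Fintype.card K)) {f : V → ZMod 2} (h0 : f 0 = 0)
    (hs : ∀ (c : K) (x : V), c ≠ 0 → f (c • x) = f x)
    (hL : ∀ L : Submodule K V, Module.finrank K L = 2 → Even (evxN f L)) : Evx K f := by
  refine ⟨h0, hs, fun a b => ?_⟩
  by_cases hb : b = 0
  · subst hb
    simp only [smul_zero, add_zero, Finset.sum_const, Finset.card_univ, nsmul_eq_mul, h0]
    rw [(ZMod.natCast_eq_zero_iff_even).2 hq, zero_mul]
  by_cases ha : a ∈ span K {b}
  · obtain ⟨c, rfl⟩ := mem_span_singleton.1 ha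
    rw [← evx_sum_smul hq h0 hs b, ← Equiv.sum_comp (Equiv.addLeft c) (fun t => f (t • b))]
    refine Finset.sum_congr rfl (fun t _ => ?_)
    rw [← add_smul]; rfl
  · have h1 := evx_line_cast hq h0 hs hb ha
    rw [(ZMod.natCast_eq_zero_iff_even).2 (hL _ (by
      rw [evx_finrank_sup ha, finrank_span_singleton hb]))] at h1
    generalize ∑ t : K, f (a + t • b) = u at *
    generalize f b = w at *
    revert u w; decide

theorem Evx.even (hq : Even (Fintype.card K)) {f : V → ZMod 2} (hf : Evx K f)
    (L : Submodule K V) (hL : Module.finrank K L = 2) : Even (evxN f L) := by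
  have hne : L ≠ ⊥ := by rintro rfl; rw [finrank_bot] at hL; omega
  obtain ⟨b, hb, hb0⟩ := Submodule.exists_mem_ne_zero_of_ne_bot hne
  have hlt : Submodule.span K {b} < L := lt_of_le_of_ne ((span_singleton_le_iff_mem _ _).2 hb) (by
    intro h; rw [← h, finrank_span_singleton hb0] at hL; omega)
  obtain ⟨a, ha, hab⟩ := SetLike.exists_of_lt hlt
  have h1 : Submodule.span K {b} ⊔ Submodule.span K {a} = L := Submodule.eq_of_le_of_finrank_eq
    (sup_le hlt.le ((span_singleton_le_iff_mem _ _).2 ha)) (by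
      rw [evx_finrank_sup hab, finrank_span_singleton hb0, hL])
  rw [← ZMod.natCast_eq_zero_iff_even, ← h1, evx_line_cast hq hf.zero hf.smul hb0 hab, hf.line]
  generalize f b = w
  revert w; decide

theorem PGPoint.rep {n : ℕ} (P : PGPoint K n) : ∃ x : Fin (n + 1) → K, x ≠ 0 ∧ P.1 = span K {x} := by
  have hP := P.2
  have hne : P.1 ≠ ⊥ := by intro h; rw [h, finrank_bot] at hP; omega
  obtain ⟨b, hb, hb0⟩ := Submodule.exists_mem_ne_zero_of_ne_bot hne
  exact ⟨b, hb0, (Submodule.eq_of_le_of_finrank_eq ((span_singleton_le_iff_mem _ _).2 hb) (by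
    rw [finrank_span_singleton hb0, hP])).symm⟩

open Classical in
/-- The indicator function of a set of points, on vectors. -/
noncomputable def evxf {n : ℕ} (S : Set (PGPoint K n)) (x : Fin (n + 1) → K) : ZMod 2 :=
  if ∃ P ∈ S, P.1 = span K {x} then 1 else 0

theorem evxf_ne {n : ℕ} {S : Set (PGPoint K n)} {x : Fin (n + 1) → K} :
    evxf S x ≠ 0 ↔ ∃ P ∈ S, P.1 = span K {x} := by
  unfold evxf
  split_ifs with h
  · simp [h]
  · simp [h]

theorem evxf_congr {a b : ZMod 2} (h : a ≠ 0 ↔ b ≠ 0) : a = b := by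
  revert a b; decide

theorem evxf_zero {n : ℕ} (S : Set (PGPoint K n)) : evxf S 0 = 0 := by
  by_contra h
  obtain ⟨P, -, hP⟩ := evxf_ne.1 h
  have := P.2
  rw [hP, Submodule.span_zero_singleton, finrank_bot] at this
  omega

theorem evxf_smul {n : ℕ} (S : Set (PGPoint K n)) (c : K) (x : Fin (n + 1) → K) (hc : c ≠ 0) :
    evxf S (c • x) = evxf S x := by
  apply evxf_congr
  rw [evxf_ne, evxf_ne, Submodule.span_singleton_smul_eq (IsUnit.mk0 c hc)]

theorem evxf_ncard {n : ℕ} (S : Set (PGPoint K n)) (W : Submodule K (Fin (n + 1) → K)) :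
    (S ∩ pts W).ncard = evxN (evxf S) W := by
  unfold evxN
  have hinj : Function.Injective (fun P : PGPoint K n => P.1) := Subtype.val_injective
  rw [← Set.ncard_image_of_injective _ hinj]
  congr 1
  ext U
  constructor
  · rintro ⟨P, ⟨hPS, hPW⟩, rfl⟩
    obtain ⟨x, hx0, hx⟩ := P.rep
    refine ⟨x, ⟨?_, evxf_ne.2 ⟨P, hPS, hx⟩⟩, hx.symm⟩
    have hPW' : P.1 ≤ W := hPW
    rwa [hx, span_singleton_le_iff_mem] at hPW'
  · rintro ⟨x, ⟨hxW, hfx⟩, rfl⟩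
    obtain ⟨P, hPS, hP⟩ := evxf_ne.1 hfx
    refine ⟨P, ⟨hPS, ?_⟩, hP⟩
    change P.1 ≤ W
    rwa [hP, span_singleton_le_iff_mem]

theorem evxf_evx (hq : Even (Fintype.card K)) {n : ℕ} {S : Set (PGPoint K n)} (hS : IsEvenType S) :
    Evx K (evxf S) := by
  refine evx_of_even hq (evxf_zero S) (evxf_smul S) (fun L hL => ?_)
  rw [← evxf_ncard]
  exact hS _ ⟨L, hL, rfl⟩

theorem evxf_hypercylinder {n : ℕ} {S : Set (PGPoint K n)} (hS : IsHypercylinder S) :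
    ∃ T : Submodule K (Fin (n + 1) → K), Module.finrank K T = n - 2 ∧ EvxPer (evxf S) T ⊤ := by
  obtain ⟨W, T, O, -, hT, -, -, hSeq⟩ := hS
  have key : ∀ x, evxf S x ≠ 0 ↔ (∃ P ∈ O, x ∈ P.1 ⊔ T) ∧ x ∉ T := by
    intro x
    rw [evxf_ne]
    constructor
    · rintro ⟨Q, hQ, hQx⟩
      rw [hSeq] at hQ
      obtain ⟨⟨P, hP, hQP⟩, hQT⟩ := hQ
      rw [hQx, span_singleton_le_iff_mem] at hQP hQT
      exact ⟨⟨P, hP, hQP⟩, hQT⟩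
    · rintro ⟨⟨P, hP, hxP⟩, hxT⟩
      have hx0 : x ≠ 0 := by rintro rfl; exact hxT T.zero_mem
      refine ⟨⟨span K {x}, finrank_span_singleton hx0⟩, ?_, rfl⟩
      rw [hSeq]
      refine ⟨⟨P, hP, ?_⟩, ?_⟩
      · simpa only [span_singleton_le_iff_mem] using hxP
      · simpa only [span_singleton_le_iff_mem] using hxT
  refine ⟨T, hT, fun v hv x _ => evxf_congr ?_⟩
  rw [key, key, T.add_mem_iff_left hv]
  have : ∀ P : PGPoint K n, x + v ∈ P.1 ⊔ T ↔ x ∈ P.1 ⊔ T := fun P =>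
    Submodule.add_mem_iff_left _ (Submodule.mem_sup_right hv)
  simp only [this]

theorem evx_base (hq : Even (Fintype.card K))
    (h3 : ∀ S : Set (PGPoint K 3), IsEvenType S →
      S.ncard = Fintype.card K * (Fintype.card K + 2) → IsHypercylinder S)
    {f : V → ZMod 2} (hf : Evx K f) (H : Submodule K V) (hHd : Module.finrank K H = 4) (hH : EvxMin f H) :
    ∃ T ≤ H, Module.finrank K T + 3 = 4 ∧ EvxPer f T H := by
  have hq2 : 2 ≤ Fintype.card K := evx_q_ge
  have hdim : Module.finrank K (Fin (3 + 1) → K) = Module.finrank K H := by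
    rw [hHd, Module.finrank_fin_fun]
  let e : (Fin (3 + 1) → K) ≃ₗ[K] H := LinearEquiv.ofFinrankEq _ _ hdim
  let φ : (Fin (3 + 1) → K) →ₗ[K] V := H.subtype.comp e.toLinearMap
  have hφinj : Function.Injective φ := Subtype.val_injective.comp e.injective
  have hφH : ∀ x, φ x ∈ H := fun x => (e x).2
  have hφsurj : ∀ y ∈ H, ∃ x, φ x = y := fun y hy => ⟨e.symm ⟨y, hy⟩, by simp [φ]⟩
  have hg : Evx K (fun x => f (φ x)) := by
    refine ⟨by simp [hf.zero], fun c x hc => ?_, fun a b => ?_⟩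
    · simp only [map_smul]; exact hf.smul c _ hc
    · simp only [map_add, map_smul]; exact hf.line _ _
  let S : Set (PGPoint K 3) := {P | ∃ x ∈ P.1, f (φ x) ≠ 0}
  have hSf : evxf S = fun x => f (φ x) := by
    funext x
    apply evxf_congr
    rw [evxf_ne]
    constructor
    · rintro ⟨P, ⟨y, hy, hfy⟩, hP⟩
      rw [hP] at hy
      obtain ⟨c, rfl⟩ := mem_span_singleton.1 hy
      have hc : c ≠ 0 := by
        rintro rfl
        rw [zero_smul, map_zero] at hfy
        exact hfy hf.zero
      rwa [map_smul, hf.smul c _ hc] at hfy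
    · intro h
      have hx0 : x ≠ 0 := by
        rintro rfl
        rw [map_zero] at h
        exact h hf.zero
      exact ⟨⟨span K {x}, finrank_span_singleton hx0⟩, ⟨x, mem_span_singleton_self x, h⟩, rfl⟩
  have hS : IsEvenType S := by
    rintro L ⟨W, hW, rfl⟩
    rw [evxf_ncard, hSf]
    exact hg.even hq W hW
  have hcard : S.ncard = Fintype.card K * (Fintype.card K + 2) := by
    have h1 : S = S ∩ pts ⊤ := by
      ext P; exact ⟨fun h => ⟨h, show P.1 ≤ ⊤ from le_top⟩, fun h => h.1⟩
    rw [h1, evxf_ncard, hSf]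
    have h2 := evxA_eq (K := K) (f := fun x => f (φ x)) hg.zero hg.smul ⊤
    have h3 : evxA (fun x => f (φ x)) (⊤ : Submodule K (Fin (3 + 1) → K)) = evxA f H := by
      unfold evxA
      rw [← Set.ncard_image_of_injective _ hφinj]
      congr 1
      ext y
      constructor
      · rintro ⟨x, ⟨-, hx⟩, rfl⟩
        exact ⟨hφH x, hx⟩
      · rintro ⟨hy, hfy⟩
        obtain ⟨x, rfl⟩ := hφsurj y hy
        exact ⟨x, ⟨trivial, hfy⟩, rfl⟩
    unfold EvxMin at hH
    rw [h3, hH, hHd] at h2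
    simp only [evxm] at h2
    have h4 := Nat.eq_of_mul_eq_mul_left (by omega : 0 < Fintype.card K - 1) h2
    rw [← h4]; ring
  obtain ⟨T, hTd, hper⟩ := evxf_hypercylinder (h3 S hS hcard)
  rw [hSf] at hper
  refine ⟨T.map φ, ?_, ?_, ?_⟩
  · rintro _ ⟨x, -, rfl⟩
    exact hφH x
  · have : Module.finrank K (T.map φ) = Module.finrank K T :=
      (Submodule.equivMapOfInjective φ hφinj T).finrank_eq.symm
    omega
  · rintro _ ⟨v, hv, rfl⟩ y hy
    obtain ⟨x, rfl⟩ := hφsurj y hy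
    rw [← map_add]
    exact hper v hv x trivial

theorem evx_final (hq : Even (Fintype.card K))
    (h3 : ∀ S : Set (PGPoint K 3), IsEvenType S →
      S.ncard = Fintype.card K * (Fintype.card K + 2) → IsHypercylinder S)
    (n : ℕ) (hn : 3 ≤ n) (S : Set (PGPoint K n)) (hS : IsEvenType S)
    (hcard : S.ncard = (Fintype.card K + 2) * Fintype.card K ^ (n - 2)) : IsHypercylinder S := by
  have hq2 : 2 ≤ Fintype.card K := evx_q_ge
  have hf := evxf_evx hq hS
  have htop : Module.finrank K (⊤ : Submodule K (Fin (n + 1) → K)) = n + 1 := by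
    rw [finrank_top, Module.finrank_fin_fun]
  have hmin : EvxMin (evxf S) (⊤ : Submodule K (Fin (n + 1) → K)) := by
    unfold EvxMin
    rw [evxA_eq hf.zero hf.smul, ← evxf_ncard, htop]
    have h1 : S ∩ pts ⊤ = S := by
      ext P; exact ⟨fun h => h.1, fun h => ⟨h, show P.1 ≤ ⊤ from le_top⟩⟩
    rw [h1, hcard]
    obtain ⟨e, rfl⟩ : ∃ e, n = e + 2 := ⟨n - 2, by omega⟩
    simp only [evxm, Nat.add_sub_cancel]
  obtain ⟨T, -, hTd, hper⟩ := evx_structure hf hq (fun H hHd hH => evx_base hq h3 hf H hHd hH)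
    (n + 1) (by omega) ⊤ htop hmin
  obtain ⟨W, hW⟩ := Submodule.exists_isCompl T
  have hWT : W ⊓ T = ⊥ := by rw [inf_comm]; exact hW.inf_eq_bot
  have hWs : W ⊔ T = ⊤ := by rw [sup_comm]; exact hW.sup_eq_top
  obtain ⟨hW3, hWA⟩ := evx_compl hWT hWs hper (by omega) hmin
  have hpos : 0 < Fintype.card K - 1 := by omega
  refine ⟨W, T, S ∩ pts W, hW3, by omega, hWT, ⟨Set.inter_subset_right, ?_, ?_⟩, ?_⟩
  · rw [evxf_ncard, Nat.card_eq_fintype_card]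
    rw [evxA_eq hf.zero hf.smul] at hWA
    exact Nat.eq_of_mul_eq_mul_left hpos hWA
  · rintro L ⟨U, hU, rfl⟩
    have h1 : S ∩ pts W ∩ pts U = S ∩ pts (W ⊓ U) := by
      ext P
      exact ⟨fun h => ⟨h.1.1, show P.1 ≤ W ⊓ U from le_inf h.1.2 h.2⟩, fun h => ⟨⟨h.1, show P.1 ≤ W from le_trans (show P.1 ≤ W ⊓ U from h.2) inf_le_left⟩,
        show P.1 ≤ U from le_trans (show P.1 ≤ W ⊓ U from h.2) inf_le_right⟩⟩
    rw [h1, evxf_ncard]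
    have h2 : evxA (evxf S) (W ⊓ U) ≤ 2 * (Fintype.card K - 1) := by
      by_cases hUW : U ≤ W
      · rw [inf_eq_right.2 hUW]
        exact hf.hyperoval W U hUW hW3 hU hWA
      · have hlt : W ⊓ U < U := lt_of_le_of_ne inf_le_right (fun h => hUW (by rw [← h]; exact inf_le_left))
        have h3 := Submodule.finrank_lt_finrank_of_lt hlt
        by_cases hz : ∀ x ∈ W ⊓ U, evxf S x = 0
        · rw [evxA_eq_zero.2 hz]; omega
        · push Not at hz
          obtain ⟨p, hp, hfp⟩ := hz
          have hp0 : p ≠ 0 := by rintro rfl; exact hfp hf.zero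
          have h4 : span K {p} = W ⊓ U := Submodule.eq_of_le_of_finrank_le
            ((span_singleton_le_iff_mem _ _).2 hp) (by rw [finrank_span_singleton hp0]; omega)
          rw [← h4, hf.span hfp]; omega
    rw [evxA_eq hf.zero hf.smul, mul_comm] at h2
    exact Nat.le_of_mul_le_mul_right h2 hpos
  · ext Q
    obtain ⟨x, hx0, hx⟩ := Q.rep
    have hQS : Q ∈ S ↔ evxf S x ≠ 0 := by
      rw [evxf_ne]
      constructor
      · intro h; exact ⟨Q, h, hx⟩
      · rintro ⟨P, hP, hPx⟩
        have : P = Q := Subtype.ext (hPx.trans hx.symm)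
        rwa [← this]
    rw [hQS]
    constructor
    · intro hfx
      have hxT : x ∉ T := fun h => hfx (hper.zero_on hf h)
      have hxs : x ∈ W ⊔ T := by rw [hWs]; trivial
      obtain ⟨p, hp, t, ht, hpt⟩ := Submodule.mem_sup.1 hxs
      have hfp : evxf S p ≠ 0 := by
        rw [← hpt, hper t ht p trivial] at hfx
        exact hfx
      obtain ⟨P, hPS, hPp⟩ := evxf_ne.1 hfp
      refine ⟨⟨P, ⟨hPS, ?_⟩, ?_⟩, ?_⟩
      · change P.1 ≤ W
        rwa [hPp, span_singleton_le_iff_mem]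
      · rw [hx, hPp, span_singleton_le_iff_mem, ← hpt]
        exact Submodule.add_mem_sup (mem_span_singleton_self p) ht
      · rwa [hx, span_singleton_le_iff_mem]
    · rintro ⟨⟨P, ⟨hPS, hPW⟩, hQP⟩, hQT⟩
      obtain ⟨p, hp0, hp⟩ := P.rep
      rw [hx, hp, span_singleton_le_iff_mem] at hQP
      rw [hx, span_singleton_le_iff_mem] at hQT
      obtain ⟨w, hw, t, ht, hwt⟩ := Submodule.mem_sup.1 hQP
      obtain ⟨c, rfl⟩ := mem_span_singleton.1 hw
      have hc : c ≠ 0 := by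
        rintro rfl
        apply hQT
        rw [← hwt, zero_smul, zero_add]; exact ht
      rw [← hwt, hper t ht _ trivial, hf.smul c p hc, evxf_ne]
      exact ⟨P, hPS, hp⟩
end evx
/-- Let `q` be an even prime power.  If every set of even type
of size `q(q+2)` in `PG(3,q)` is a hypercylinder, then for every `n ≥ 3`, every
set of even type of size `(q+2)q^{n-2}` in `PG(n,q)` is a hypercylinder. -/
theorem stmt2 {K : Type*} [Field K] [Finite K] (hq : Even (Nat.card K))
    (h3 : ∀ S : Set (PGPoint K 3), IsEvenType S →
      S.ncard = Nat.card K * (Nat.card K + 2) → IsHypercylinder S) :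
    ∀ n, 3 ≤ n → ∀ S : Set (PGPoint K n), IsEvenType S →
      S.ncard = (Nat.card K + 2) * Nat.card K ^ (n - 2) →
      IsHypercylinder S := by
  have := Fintype.ofFinite K
  rw [Nat.card_eq_fintype_card] at *
  exact evx_final hq h3
end
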